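/- arXiv:solv-int/9701005 — 2 statements merged into one kernel-verified Lean document; each statement's English description precedes it below -/
import Mathlib

section
/- In the even Wronskian setup with n = 2k, suppose the superfields a₀, …, a_{2k−1} solve the kernel system, and that det DW^{(1)} and det(W^{(0)} − W^{(1)}(DW^{(1)})⁻¹DW^{(0)}) are invertible even superfields. Then a_{2k−2} = − (sdet 𝒲̂)·(sdet 𝒲)⁻¹, where 𝒲̂ = [[Ŵ^{(0)}, Ŵ^{(1)}], [DW^{(0)}, DW^{(1)}]] and Ŵ^{(i)} is the matrix W^{(i)} with its last row ∂^{k−1}θ^{(i)} replaced by b^{(i)} = ∂^k θ^{(i)}. -/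
noncomputable section
open scoped BigOperators

/-- The exterior algebra `Λ` of `ℝ^N`. -/
abbrev SuperAlg (N : ℕ) : Type := ExteriorAlgebra ℝ (Fin N → ℝ)

/-- The even part `Λ₀` of the exterior algebra. -/
def LambdaEven (N : ℕ) : Submodule ℝ (SuperAlg N) :=
  CliffordAlgebra.evenOdd (0 : QuadraticForm ℝ (Fin N → ℝ)) 0

/-- The odd part `Λ₁` of the exterior algebra. -/
def LambdaOdd (N : ℕ) : Submodule ℝ (SuperAlg N) :=
  CliffordAlgebra.evenOdd (0 : QuadraticForm ℝ (Fin N → ℝ)) 1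

/-- A superfield: a pair `(f₀, f₁)` of maps `ℝ² → Λ`, encoding
`f(x,t,ϑ) = f₀(x,t) + ϑ f₁(x,t)`. -/
@[ext] structure SF (N : ℕ) where
  c0 : ℝ → ℝ → SuperAlg N
  c1 : ℝ → ℝ → SuperAlg N

namespace SF
variable {N : ℕ}

instance : Zero (SF N) := ⟨⟨0, 0⟩⟩
instance : Add (SF N) := ⟨fun f g => ⟨f.c0 + g.c0, f.c1 + g.c1⟩⟩
instance : Neg (SF N) := ⟨fun f => ⟨-f.c0, -f.c1⟩⟩
instance : Sub (SF N) := ⟨fun f g => ⟨f.c0 - g.c0, f.c1 - g.c1⟩⟩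
instance : SMul ℕ (SF N) := ⟨fun n f => ⟨n • f.c0, n • f.c1⟩⟩
instance : SMul ℤ (SF N) := ⟨fun n f => ⟨n • f.c0, n • f.c1⟩⟩
instance : SMul ℝ (SF N) := ⟨fun r f => ⟨r • f.c0, r • f.c1⟩⟩

instance : AddCommGroup (SF N) :=
  Function.Injective.addCommGroup
    (M₂ := (ℝ → ℝ → SuperAlg N) × (ℝ → ℝ → SuperAlg N))
    (fun f => (f.c0, f.c1))
    (fun a b h => by cases a; cases b; simpa using h)
    rfl (fun _ _ => rfl) (fun _ => rfl) (fun _ _ => rfl) (fun _ _ => rfl) (fun _ _ => rfl)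

instance : One (SF N) := ⟨⟨fun _ _ => 1, fun _ _ => 0⟩⟩

/-- The product of superfields: `(fg)₀ = f₀g₀`,
`(fg)₁ = f₁g₀ + σ(f₀)g₁` where `σ` is the grade involution of `Λ`
(this is the bilinear extension of the parity-sign formula for homogeneous factors). -/
instance : Mul (SF N) := ⟨fun f g =>
  ⟨fun x t => f.c0 x t * g.c0 x t,
   fun x t => f.c1 x t * g.c0 x t + CliffordAlgebra.involute (f.c0 x t) * g.c1 x t⟩⟩

/-- An even superfield. -/
def IsEven (f : SF N) : Prop :=
  (∀ x t, f.c0 x t ∈ LambdaEven N) ∧ (∀ x t, f.c1 x t ∈ LambdaOdd N)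

/-- An odd superfield. -/
def IsOdd (f : SF N) : Prop :=
  (∀ x t, f.c0 x t ∈ LambdaOdd N) ∧ (∀ x t, f.c1 x t ∈ LambdaEven N)

/-- A superfield is invertible when `f₀(x,t)` is invertible in `Λ` for all `(x,t)`. -/
def Invertible (f : SF N) : Prop := ∀ x t, IsUnit (f.c0 x t)

/-- The multiplicative inverse of a superfield (junk unless `f` is invertible). -/
def sinv (f : SF N) : SF N :=
  ⟨fun x t => Ring.inverse (f.c0 x t),
   fun x t => -(Ring.inverse (CliffordAlgebra.involute (f.c0 x t)) * f.c1 x t *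
      Ring.inverse (f.c0 x t))⟩

end SF

/-- Derivative of a `Λ`-valued function of one real variable, characterized through all
linear functionals (junk value `0` when not differentiable). -/
def derLam {N : ℕ} (g : ℝ → SuperAlg N) (x : ℝ) : SuperAlg N := by
  classical
  exact if h : ∃ d : SuperAlg N, ∀ l : SuperAlg N →ₗ[ℝ] ℝ,
      HasDerivAt (fun y => l (g y)) (l d) x
    then h.choose else 0

/-- Smoothness of a `Λ`-valued function on `ℝ²`. -/
def SmoothLam {N : ℕ} (g : ℝ → ℝ → SuperAlg N) : Prop :=
  ∀ l : SuperAlg N →ₗ[ℝ] ℝ, ContDiff ℝ (⊤ : ℕ∞) (fun p : ℝ × ℝ => l (g p.1 p.2))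

namespace SF
variable {N : ℕ}

/-- A superfield is smooth when both components are. -/
def Smooth (f : SF N) : Prop := SmoothLam f.c0 ∧ SmoothLam f.c1

/-- `∂f`, the `x`-derivative. -/
def dx (f : SF N) : SF N :=
  ⟨fun x t => derLam (fun y => f.c0 y t) x, fun x t => derLam (fun y => f.c1 y t) x⟩

/-- `∂ₜf`, the `t`-derivative. -/
def dt (f : SF N) : SF N :=
  ⟨fun x t => derLam (fun s => f.c0 x s) t, fun x t => derLam (fun s => f.c1 x s) t⟩

/-- The odd superderivative `D`, with `Df = (f₁, ∂ₓf₀)`, so `D ∘ D = ∂`. -/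
def Dsd (f : SF N) : SF N := ⟨f.c1, fun x t => derLam (fun y => f.c0 y t) x⟩

end SF

/-- `D^n`. -/
def Dpow {N : ℕ} : ℕ → SF N → SF N
  | 0, f => f
  | m + 1, f => (Dpow m f).Dsd

/-- `∂^n`. -/
def Xpow {N : ℕ} : ℕ → SF N → SF N
  | 0, f => f
  | m + 1, f => (Xpow m f).dx

/-- `f` has the parity `(−1)^m`. -/
def parityAt {N : ℕ} (f : SF N) (m : ℕ) : Prop :=
  if m % 2 = 0 then f.IsEven else f.IsOdd

/-- The Manin–Radul supersymmetric KdV system. -/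
def MRSKdV {N : ℕ} (α u : SF N) : Prop :=
  α.dt = (1/4 : ℝ) • (α.dx.dx + (3:ℝ) • (α * α.Dsd) + (6:ℝ) • (α * u)).dx ∧
  u.dt = (1/4 : ℝ) • (u.dx.dx + (3:ℝ) • (u * u) + (3:ℝ) • (α * u.Dsd)).dx

/-- The Lax operator `L = ∂² + αD + u`. -/
def Lop {N : ℕ} (α u ψ : SF N) : SF N := ψ.dx.dx + α * ψ.Dsd + u * ψ

/-- The operator `M = (1/2)α∂D + λ∂ + (1/2)u∂ − (1/4)(∂α)D − (1/4)(∂u)`. -/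
def Mop {N : ℕ} (α u : SF N) (lam : ℝ) (ψ : SF N) : SF N :=
  (1/2 : ℝ) • (α * ψ.Dsd.dx) + lam • ψ.dx + (1/2 : ℝ) • (u * ψ.dx)
    - (1/4 : ℝ) • (α.dx * ψ.Dsd) - (1/4 : ℝ) • (u.dx * ψ)

/-- The linear system `Lψ = λψ`, `∂ₜψ = Mψ` associated with `(α,u)` at `λ`. -/
def LinSys {N : ℕ} (α u : SF N) (lam : ℝ) (ψ : SF N) : Prop :=
  Lop α u ψ = lam • ψ ∧ ψ.dt = Mop α u lam ψ

/-- `δ₀ = −(Dθ₀)θ₀⁻¹`. -/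
def delta0 {N : ℕ} (θ : SF N) : SF N := -(θ.Dsd * θ.sinv)

/-- The Darboux-transformed `α̂ = −α − 2∂δ₀`. -/
def hatAlpha {N : ℕ} (α θ : SF N) : SF N := -α - (2:ℝ) • (delta0 θ).dx

/-- The Darboux-transformed `û = u + Dα + 2δ₀(α + ∂δ₀)`. -/
def hatU {N : ℕ} (α u θ : SF N) : SF N :=
  u + α.Dsd + (2:ℝ) • (delta0 θ * (α + (delta0 θ).dx))

/-- `darbIter θ m j = θ_j[m]`, the `j`-th seed after `m` Darboux steps. -/
def darbIter {N : ℕ} (θ : ℕ → SF N) : ℕ → ℕ → SF N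
  | 0, j => θ j
  | m + 1, j => (darbIter θ m j).Dsd + delta0 (darbIter θ m m) * darbIter θ m j

/-- `Titer θ n ψ = T_n ψ = (D+δ_{n−1})⋯(D+δ₀)ψ`. -/
def Titer {N : ℕ} (θ : ℕ → SF N) : ℕ → SF N → SF N
  | 0, ψ => ψ
  | m + 1, ψ => (Titer θ m ψ).Dsd + delta0 (darbIter θ m m) * Titer θ m ψ

/-- Determinant of a matrix of superfields: Leibniz formula with rows in
ascending order (for matrices of commuting, e.g. even, entries this is the usual
determinant, and when exactly one row is odd it agrees with the Laplace
expansion along that row). -/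
def detSF {N k : ℕ} (M : Matrix (Fin k) (Fin k) (SF N)) : SF N :=
  ∑ σ : Equiv.Perm (Fin k),
    ((Equiv.Perm.sign σ : ℤ)) • (((List.finRange k).map fun i => M i (σ i)).prod)

/-- Entrywise `D`-derivative of a matrix of superfields. -/
def DmatSF {N m n : ℕ} (M : Matrix (Fin m) (Fin n) (SF N)) : Matrix (Fin m) (Fin n) (SF N) :=
  Matrix.of fun i j => (M i j).Dsd

/-- The embedding `Fin (k−1) → Fin k` skipping `j`. -/
def dropIdx {k : ℕ} (j : Fin k) (i : Fin (k - 1)) : Fin k :=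
  ⟨if i.1 < j.1 then i.1 else i.1 + 1, by
    have h1 := i.2; have h2 := j.2; split <;> omega⟩

/-- The minor of `M` obtained by deleting row `j` and column `i`. -/
def minorSF {N k : ℕ} (M : Matrix (Fin k) (Fin k) (SF N)) (j i : Fin k) :
    Matrix (Fin (k-1)) (Fin (k-1)) (SF N) :=
  M.submatrix (dropIdx j) (dropIdx i)

/-- Adjugate matrix (matrix of cofactors, transposed). -/
def adjSF {N k : ℕ} (M : Matrix (Fin k) (Fin k) (SF N)) : Matrix (Fin k) (Fin k) (SF N) :=
  Matrix.of fun i j => ((-1 : ℤ) ^ (i.1 + j.1)) • detSF (minorSF M j i)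

/-- Inverse of a matrix of (even) superfields, via the adjugate
(junk unless `detSF M` is invertible). -/
def invSF {N k : ℕ} (M : Matrix (Fin k) (Fin k) (SF N)) : Matrix (Fin k) (Fin k) (SF N) :=
  Matrix.of fun i j => (detSF M).sinv * adjSF M i j

section EvenWronskian

variable {N : ℕ}

/-- `θ^{(0)} = (θ₀, θ₂, …)`. -/
def evenSeq (θ : ℕ → SF N) : ℕ → SF N := fun j => θ (2 * j)

/-- `θ^{(1)} = (θ₁, θ₃, …)`. -/
def oddSeq (θ : ℕ → SF N) : ℕ → SF N := fun j => θ (2 * j + 1)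

/-- The `k×k` Wronski matrix with rows `v, ∂v, …, ∂^{k−1}v`. -/
def Wmat (N : ℕ) (k : ℕ) (v : ℕ → SF N) : Matrix (Fin k) (Fin k) (SF N) :=
  Matrix.of fun i j => Xpow i.1 (v j.1)

/-- The Wronski matrix with last row replaced by `∂^k v`. -/
def WmatHat (N : ℕ) (k : ℕ) (v : ℕ → SF N) : Matrix (Fin k) (Fin k) (SF N) :=
  Matrix.of fun i j => if i.1 = k - 1 then Xpow k (v j.1) else Xpow i.1 (v j.1)

/-- The Wronski matrix with rows `Dv, D∂v, …, D∂^{k−2}v` and last row `∂^k v`. -/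
def WmatBarD (N : ℕ) (k : ℕ) (v : ℕ → SF N) : Matrix (Fin k) (Fin k) (SF N) :=
  Matrix.of fun i j => if i.1 = k - 1 then Xpow k (v j.1) else (Xpow i.1 (v j.1)).Dsd

/-- `W^{(0)}` (even case, `n = 2k`). -/
def W0E (N k : ℕ) (θ : ℕ → SF N) : Matrix (Fin k) (Fin k) (SF N) := Wmat N k (evenSeq θ)

/-- `W^{(1)}` (even case, `n = 2k`). -/
def W1E (N k : ℕ) (θ : ℕ → SF N) : Matrix (Fin k) (Fin k) (SF N) := Wmat N k (oddSeq θ)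

/-- The Schur complement `W^{(0)} − W^{(1)}(DW^{(1)})⁻¹DW^{(0)}`. -/
def SchurE (N k : ℕ) (θ : ℕ → SF N) : Matrix (Fin k) (Fin k) (SF N) :=
  W0E N k θ - W1E N k θ * invSF (DmatSF (W1E N k θ)) * DmatSF (W0E N k θ)

/-- The Schur complement `DW^{(1)} − (DW^{(0)})(W^{(0)})⁻¹W^{(1)}`. -/
def SchurE2 (N k : ℕ) (θ : ℕ → SF N) : Matrix (Fin k) (Fin k) (SF N) :=
  DmatSF (W1E N k θ) - DmatSF (W0E N k θ) * invSF (W0E N k θ) * W1E N k θ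

/-- `sdet 𝒲` (even case). -/
def sdetE (N k : ℕ) (θ : ℕ → SF N) : SF N :=
  detSF (SchurE N k θ) * (detSF (DmatSF (W1E N k θ))).sinv

/-- The Schur complement of the block matrix `𝒲̂` (even case). -/
def SchurEHat (N k : ℕ) (θ : ℕ → SF N) : Matrix (Fin k) (Fin k) (SF N) :=
  WmatHat N k (evenSeq θ) - WmatHat N k (oddSeq θ) * invSF (DmatSF (W1E N k θ)) * DmatSF (W0E N k θ)

/-- `sdet 𝒲̂` (even case). -/
def sdetEHat (N k : ℕ) (θ : ℕ → SF N) : SF N :=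
  detSF (SchurEHat N k θ) * (detSF (DmatSF (W1E N k θ))).sinv

end EvenWronskian

section OddWronskian

/-- `W^{(0)}`, a `(k+1)×(k+1)` matrix (odd case, `n = 2k+1`). -/
def W0O (N k : ℕ) (θ : ℕ → SF N) : Matrix (Fin (k+1)) (Fin (k+1)) (SF N) :=
  Matrix.of fun i j => Xpow i.1 (θ (2 * j.1))

/-- `W^{(1)}`, a `(k+1)×k` matrix (odd case). -/
def W1O (N k : ℕ) (θ : ℕ → SF N) : Matrix (Fin (k+1)) (Fin k) (SF N) :=
  Matrix.of fun i j => Xpow i.1 (θ (2 * j.1 + 1))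

/-- `W̃^{(0)}`: `W^{(0)}` with its last row removed. -/
def Wtil0 (N k : ℕ) (θ : ℕ → SF N) : Matrix (Fin k) (Fin (k+1)) (SF N) :=
  Matrix.of fun i j => Xpow i.1 (θ (2 * j.1))

/-- `W̃^{(1)}`: `W^{(1)}` with its last row removed. -/
def Wtil1 (N k : ℕ) (θ : ℕ → SF N) : Matrix (Fin k) (Fin k) (SF N) :=
  Matrix.of fun i j => Xpow i.1 (θ (2 * j.1 + 1))

/-- `W̌^{(0)}`: `W^{(0)}` with its second-to-last row removed. -/
def Wchk0 (N k : ℕ) (θ : ℕ → SF N) : Matrix (Fin k) (Fin (k+1)) (SF N) :=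
  Matrix.of fun i j => Xpow (if i.1 = k - 1 then k else i.1) (θ (2 * j.1))

/-- `W̌^{(1)}`: `W^{(1)}` with its second-to-last row removed. -/
def Wchk1 (N k : ℕ) (θ : ℕ → SF N) : Matrix (Fin k) (Fin k) (SF N) :=
  Matrix.of fun i j => Xpow (if i.1 = k - 1 then k else i.1) (θ (2 * j.1 + 1))

/-- `Ŵ^{(0)}`: `W^{(0)}` with last row `∂^k θ^{(0)}` replaced by `D∂^k θ^{(0)}`. -/
def W0OHat (N k : ℕ) (θ : ℕ → SF N) : Matrix (Fin (k+1)) (Fin (k+1)) (SF N) :=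
  Matrix.of fun i j => if i.1 = k then Dpow (2*k+1) (θ (2 * j.1)) else Xpow i.1 (θ (2 * j.1))

/-- `Ŵ^{(1)}`: `W^{(1)}` with last row `∂^k θ^{(1)}` replaced by `D∂^k θ^{(1)}`. -/
def W1OHat (N k : ℕ) (θ : ℕ → SF N) : Matrix (Fin (k+1)) (Fin k) (SF N) :=
  Matrix.of fun i j => if i.1 = k then Dpow (2*k+1) (θ (2 * j.1 + 1)) else Xpow i.1 (θ (2 * j.1 + 1))

/-- The Schur complement `W^{(0)} − W^{(1)}(DW̃^{(1)})⁻¹DW̃^{(0)}`. -/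
def SchurO (N k : ℕ) (θ : ℕ → SF N) : Matrix (Fin (k+1)) (Fin (k+1)) (SF N) :=
  W0O N k θ - W1O N k θ * invSF (DmatSF (Wtil1 N k θ)) * DmatSF (Wtil0 N k θ)

/-- The Schur complement `W^{(0)} − W^{(1)}(DW̌^{(1)})⁻¹DW̌^{(0)}`. -/
def SchurOchk (N k : ℕ) (θ : ℕ → SF N) : Matrix (Fin (k+1)) (Fin (k+1)) (SF N) :=
  W0O N k θ - W1O N k θ * invSF (DmatSF (Wchk1 N k θ)) * DmatSF (Wchk0 N k θ)

/-- The Schur complement `Ŵ^{(0)} − Ŵ^{(1)}(DW̃^{(1)})⁻¹DW̃^{(0)}`. -/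
def SchurOHat (N k : ℕ) (θ : ℕ → SF N) : Matrix (Fin (k+1)) (Fin (k+1)) (SF N) :=
  W0OHat N k θ - W1OHat N k θ * invSF (DmatSF (Wtil1 N k θ)) * DmatSF (Wtil0 N k θ)

/-- `sdet 𝒲` (odd case). -/
def sdetO (N k : ℕ) (θ : ℕ → SF N) : SF N :=
  detSF (SchurO N k θ) * (detSF (DmatSF (Wtil1 N k θ))).sinv

/-- `sdet 𝒲̌` (odd case). -/
def sdetOchk (N k : ℕ) (θ : ℕ → SF N) : SF N :=
  detSF (SchurOchk N k θ) * (detSF (DmatSF (Wchk1 N k θ))).sinv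

/-- The quotient `det(Ŵ^{(0)} − Ŵ^{(1)}(DW̃^{(1)})⁻¹DW̃^{(0)}) / det(W^{(0)} − W^{(1)}(DW̃^{(1)})⁻¹DW̃^{(0)})`. -/
def Qodd (N k : ℕ) (θ : ℕ → SF N) : SF N :=
  detSF (SchurOHat N k θ) * (detSF (SchurO N k θ)).sinv

end OddWronskian

namespace SFProof
variable {N : ℕ}

lemma iota_mul (v : Fin N → ℝ) (g : SuperAlg N) :
    ExteriorAlgebra.ι ℝ v * g = CliffordAlgebra.involute g * ExteriorAlgebra.ι ℝ v := by
  induction g using CliffordAlgebra.induction with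
  | algebraMap r => rw [AlgHom.commutes]; exact (Algebra.commutes r _).symm
  | ι x =>
    rw [CliffordAlgebra.involute_ι, neg_mul]
    exact eq_neg_of_add_eq_zero_left (ExteriorAlgebra.ι_add_mul_swap v x)
  | mul a b ha hb => rw [map_mul, ← mul_assoc, ha, mul_assoc, hb, mul_assoc]
  | add a b ha hb => rw [map_add, mul_add, ha, hb, add_mul]

lemma even_comm {x : SuperAlg N} (hx : x ∈ LambdaEven N) (g : SuperAlg N) : x * g = g * x := by
  induction x, hx using CliffordAlgebra.even_induction with
  | algebraMap r => exact Algebra.commutes r _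
  | add x y hx hy ihx ihy => rw [add_mul, ihx, ihy, mul_add]
  | ι_mul_ι_mul m₁ m₂ x hx ih =>
    rw [mul_assoc, ih, mul_assoc, ← mul_assoc _ g x]
    have h := iota_mul m₂ g
    have h' := iota_mul m₁ (CliffordAlgebra.involute g)
    rw [CliffordAlgebra.involute_involute] at h'
    erw [h]
    rw [← mul_assoc, ← mul_assoc]
    erw [h']
    simp only [mul_assoc]

lemma odd_comm {x : SuperAlg N} (hx : x ∈ LambdaOdd N) (g : SuperAlg N) :
    x * g = CliffordAlgebra.involute g * x := by
  induction x, hx using CliffordAlgebra.odd_induction with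
  | ι v => exact iota_mul v g
  | add x y hx hy ihx ihy => rw [add_mul, ihx, ihy, mul_add]
  | ι_mul_ι_mul m₁ m₂ x hx ih =>
    have h := even_comm (N := N) (CliffordAlgebra.ι_mul_ι_mem_evenOdd_zero _ m₁ m₂)
      (CliffordAlgebra.involute g)
    rw [mul_assoc, ih, ← mul_assoc]
    erw [h]
    rw [mul_assoc]

lemma inv_even {x : SuperAlg N} (hx : x ∈ LambdaEven N) : CliffordAlgebra.involute x = x :=
  CliffordAlgebra.involute_eq_of_mem_even hx

lemma inv_odd {x : SuperAlg N} (hx : x ∈ LambdaOdd N) : CliffordAlgebra.involute x = -x :=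
  CliffordAlgebra.involute_eq_of_mem_odd hx

@[simp] lemma mul_c0 (f g : SF N) (x t : ℝ) : (f * g).c0 x t = f.c0 x t * g.c0 x t := rfl
@[simp] lemma mul_c1 (f g : SF N) (x t : ℝ) : (f * g).c1 x t =
  f.c1 x t * g.c0 x t + CliffordAlgebra.involute (f.c0 x t) * g.c1 x t := rfl
@[simp] lemma add_c0 (f g : SF N) (x t : ℝ) : (f + g).c0 x t = f.c0 x t + g.c0 x t := rfl
@[simp] lemma add_c1 (f g : SF N) (x t : ℝ) : (f + g).c1 x t = f.c1 x t + g.c1 x t := rfl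
@[simp] lemma one_c0 (x t : ℝ) : (1 : SF N).c0 x t = 1 := rfl
@[simp] lemma one_c1 (x t : ℝ) : (1 : SF N).c1 x t = 0 := rfl
@[simp] lemma zero_c0 (x t : ℝ) : (0 : SF N).c0 x t = 0 := rfl
@[simp] lemma zero_c1 (x t : ℝ) : (0 : SF N).c1 x t = 0 := rfl

lemma sf_ext {f g : SF N} (h0 : ∀ x t, f.c0 x t = g.c0 x t) (h1 : ∀ x t, f.c1 x t = g.c1 x t) :
    f = g := SF.ext (funext fun x => funext fun t => h0 x t) (funext fun x => funext fun t => h1 x t)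

@[reducible] def instRing : Ring (SF N) :=
  { (inferInstance : AddCommGroup (SF N)), (inferInstance : Mul (SF N)),
    (inferInstance : One (SF N)) with
    mul_assoc := fun a b c => sf_ext (fun x t => by simp [mul_assoc])
      (fun x t => by simp [mul_assoc, add_mul, mul_add, add_assoc])
    one_mul := fun a => sf_ext (fun x t => by simp) (fun x t => by simp)
    mul_one := fun a => sf_ext (fun x t => by simp) (fun x t => by simp)
    zero_mul := fun a => sf_ext (fun x t => by simp) (fun x t => by simp)
    mul_zero := fun a => sf_ext (fun x t => by simp) (fun x t => by simp)
    left_distrib := fun a b c => sf_ext (fun x t => by simp [mul_add])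
      (fun x t => by simp [mul_add]; abel)
    right_distrib := fun a b c => sf_ext (fun x t => by simp [add_mul])
      (fun x t => by simp [add_mul]; abel) }

attribute [local instance] instRing

abbrev Z (N : ℕ) := Subring.center (SF N)

lemma even_central {f : SF N} (hf : f.IsEven) : f ∈ Z N := by
  rw [Subring.mem_center_iff]
  intro g
  refine sf_ext (fun x t => (even_comm (hf.1 x t) _).symm) (fun x t => ?_)
  simp only [mul_c1]
  rw [← even_comm (hf.1 x t), odd_comm (hf.2 x t), inv_even (hf.1 x t), add_comm]

lemma odd_mul_odd {f g : SF N} (hf : f.IsOdd) (hg : g.IsOdd) : (f * g).IsEven := by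
  refine ⟨fun x t => ?_, fun x t => ?_⟩
  · have := CliffordAlgebra.evenOdd_mul_le _ _ _ (Submodule.mul_mem_mul (hf.1 x t) (hg.1 x t))
    exact this
  · have h1 := CliffordAlgebra.evenOdd_mul_le _ _ _ (Submodule.mul_mem_mul (hf.2 x t) (hg.1 x t))
    have h2 := CliffordAlgebra.evenOdd_mul_le _ _ _ (Submodule.mul_mem_mul (hf.1 x t) (hg.2 x t))
    simp only [mul_c1]
    rw [inv_odd (hf.1 x t), neg_mul]
    exact Submodule.add_mem (LambdaOdd N) h1 (Submodule.neg_mem (LambdaOdd N) h2)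

lemma derLam_mem (p : Submodule ℝ (SuperAlg N)) (g : ℝ → SuperAlg N) (hg : ∀ x, g x ∈ p) (x : ℝ) :
    derLam g x ∈ p := by
  classical
  unfold derLam
  split_ifs with h
  · have hd := h.choose_spec
    by_contra hc
    obtain ⟨l, hl, hp⟩ := Submodule.exists_le_ker_of_notMem hc
    have h0 : (fun y => l (g y)) = fun _ => 0 := funext fun y => hp (hg y)
    have := hd l
    rw [h0] at this
    exact hl (this.unique (hasDerivAt_const x (0:ℝ)))
  · exact p.zero_mem

lemma dx_even {f : SF N} (hf : f.IsEven) : f.dx.IsEven :=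
  ⟨fun x t => derLam_mem _ _ (fun y => hf.1 y t) x, fun x t => derLam_mem _ _ (fun y => hf.2 y t) x⟩
lemma dx_odd {f : SF N} (hf : f.IsOdd) : f.dx.IsOdd :=
  ⟨fun x t => derLam_mem _ _ (fun y => hf.1 y t) x, fun x t => derLam_mem _ _ (fun y => hf.2 y t) x⟩
lemma D_even {f : SF N} (hf : f.IsEven) : f.Dsd.IsOdd :=
  ⟨hf.2, fun x t => derLam_mem _ _ (fun y => hf.1 y t) x⟩
lemma D_odd {f : SF N} (hf : f.IsOdd) : f.Dsd.IsEven :=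
  ⟨hf.2, fun x t => derLam_mem _ _ (fun y => hf.1 y t) x⟩
lemma X_even {f : SF N} (hf : f.IsEven) : ∀ n, (Xpow n f).IsEven
  | 0 => hf
  | n + 1 => dx_even (X_even hf n)
lemma X_odd {f : SF N} (hf : f.IsOdd) : ∀ n, (Xpow n f).IsOdd
  | 0 => hf
  | n + 1 => dx_odd (X_odd hf n)

lemma Dpow_even (f : SF N) : ∀ n, Dpow (2 * n) f = Xpow n f
  | 0 => rfl
  | n + 1 => by
    show (Dpow (2 * n) f).Dsd.Dsd = (Xpow n f).dx
    rw [Dpow_even f n]; rfl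
lemma Dpow_odd (f : SF N) (n) : Dpow (2 * n + 1) f = (Xpow n f).Dsd := by
  show (Dpow (2 * n) f).Dsd = _
  rw [Dpow_even]

lemma mul_sinv {f : SF N} (hf : f.Invertible) : f * f.sinv = 1 := by
  have hu : ∀ x t, IsUnit (CliffordAlgebra.involute (f.c0 x t)) := fun x t => (hf x t).map _
  refine sf_ext (fun x t => Ring.mul_inverse_cancel _ (hf x t)) (fun x t => ?_)
  simp only [mul_c1, SF.sinv, one_c1, mul_neg, ← mul_assoc]
  rw [Ring.mul_inverse_cancel _ (hu x t)]
  simp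

lemma sinv_central {f : SF N} (hf : f.Invertible) (hz : f ∈ Z N) : f.sinv ∈ Z N := by
  have h1 := mul_sinv hf
  rw [Subring.mem_center_iff] at hz ⊢
  have h2 : f.sinv * f = 1 := by rw [hz, h1]
  intro g
  calc g * f.sinv = (f.sinv * f) * g * f.sinv := by rw [h2, one_mul]
    _ = f.sinv * (g * f) * f.sinv := by rw [hz g]; simp only [mul_assoc]
    _ = f.sinv * g := by rw [mul_assoc, mul_assoc g, h1, mul_one]

/-- coercion of matrices -/
abbrev co {m n : ℕ} (M : Matrix (Fin m) (Fin n) (Z N)) : Matrix (Fin m) (Fin n) (SF N) :=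
  M.map (Subring.subtype (Z N))

lemma co_mul {m n p : ℕ} (A : Matrix (Fin m) (Fin n) (Z N)) (B : Matrix (Fin n) (Fin p) (Z N)) :
    co (A * B) = co A * co B := Matrix.map_mul

lemma det_co {k : ℕ} (M : Matrix (Fin k) (Fin k) (Z N)) : detSF (co M) = (M.det : SF N) := by
  rw [← Matrix.det_transpose, Matrix.det_apply]
  show _ = Subring.subtype (Z N) _
  rw [map_sum]
  unfold detSF
  refine Finset.sum_congr rfl fun σ _ => ?_
  rw [Units.smul_def, map_zsmul, Fin.prod_univ_def, map_list_prod, List.map_map]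
  rfl

lemma adj_co {k : ℕ} (M : Matrix (Fin k) (Fin k) (Z N)) : adjSF (co M) = co M.adjugate := by
  cases k with
  | zero => exact Matrix.ext fun i => i.elim0
  | succ n =>
    refine Matrix.ext fun i j => ?_
    have hs : ∀ j : Fin (n+1), (dropIdx j : Fin n → Fin (n+1)) = j.succAbove := by
      intro j; funext l
      apply Fin.ext
      simp only [dropIdx, Fin.succAbove, Fin.lt_def]
      by_cases h : (l : ℕ) < (j : ℕ)
      · rw [if_pos h]
        erw [if_pos h]
        rfl
      · rw [if_neg h]
        erw [if_neg h]
        rfl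
    have : minorSF (co M) j i = co (M.submatrix j.succAbove i.succAbove) := by
      rw [← hs, ← hs]; rfl
    show ((-1 : ℤ) ^ (i.1 + j.1)) • detSF (minorSF (co M) j i) =
      Subring.subtype (Z N) (M.adjugate i j)
    rw [Matrix.adjugate_fin_succ_eq_det_submatrix, map_mul, map_pow, map_neg, map_one, this]
    have hd := det_co (M.submatrix j.succAbove i.succAbove)
    refine Eq.trans (congrArg (fun z => ((-1 : ℤ) ^ (i.1 + j.1)) • z) hd) ?_
    rw [zsmul_eq_mul, add_comm]
    push_cast
    rfl

lemma inv_co {k : ℕ} (M : Matrix (Fin k) (Fin k) (Z N)) (h : (detSF (co M)).Invertible) :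
    ∃ P : Matrix (Fin k) (Fin k) (Z N), invSF (co M) = co P ∧ M * P = 1 := by
  have hz : (detSF (co M)).sinv ∈ Z N := sinv_central h (by rw [det_co]; exact M.det.2)
  have h1 := mul_sinv h
  refine ⟨(⟨_, hz⟩ : Z N) • M.adjugate, ?_, ?_⟩
  · refine Matrix.ext fun i j => ?_
    show (detSF (co M)).sinv * adjSF (co M) i j = _
    rw [adj_co]; rfl
  · rw [Matrix.mul_smul, Matrix.mul_adjugate, smul_smul]
    have hh : (⟨_, hz⟩ : Z N) * M.det = 1 := by
      apply Subtype.ext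
      show (detSF (co M)).sinv * (M.det : SF N) = 1
      rw [← det_co, ← Subring.mem_center_iff.1 hz, h1]
    rw [hh, one_smul]

lemma exists_co {m n : ℕ} (M : Matrix (Fin m) (Fin n) (SF N)) (h : ∀ i j, M i j ∈ Z N) :
    ∃ M', M = co M' := ⟨Matrix.of fun i j => ⟨M i j, h i j⟩, rfl⟩

lemma sum_split {A : Type*} [AddCommMonoid A] (k : ℕ) (f : Fin (2 * k) → A) :
    ∑ i, f i = ∑ i : Fin k, f ⟨2 * i.1, by omega⟩ + ∑ i : Fin k, f ⟨2 * i.1 + 1, by omega⟩ := by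
  rw [← Finset.sum_add_distrib,
    ← (finProdFinEquiv.trans (finCongr (Nat.mul_comm k 2))).sum_comp, Fintype.sum_prod_type]
  refine Finset.sum_congr rfl fun i _ => ?_
  rw [Fin.sum_univ_two]
  congr 2 <;> apply Fin.ext <;> simp [add_comm]

open Matrix in
lemma row_calc {k : ℕ} (A0 A1 b0 b1 : Fin k → SF N) (W0 W1 D0 M P : Matrix (Fin k) (Fin k) (SF N))
    (h0 : b0 + (A0 ᵥ* W0 + A1 ᵥ* D0) = 0) (h1 : b1 + (A0 ᵥ* W1 + A1 ᵥ* M) = 0) (hP : M * P = 1) :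
    b0 - b1 ᵥ* (P * D0) = - (A0 ᵥ* (W0 - W1 * P * D0)) := by
  rw [eq_neg_of_add_eq_zero_left h0, eq_neg_of_add_eq_zero_left h1, Matrix.neg_vecMul,
    Matrix.add_vecMul, Matrix.vecMul_vecMul, Matrix.vecMul_vecMul, ← Matrix.mul_assoc M, hP,
    Matrix.one_mul, Matrix.vecMul_sub, Matrix.mul_assoc]
  abel

open Matrix in
theorem main (k : ℕ) (hk : 1 ≤ k) (θ : ℕ → SF N)
    (hθp : ∀ j < 2*k, parityAt (θ j) j)
    (a : Fin (2*k) → SF N) (hap : ∀ i : Fin (2*k), parityAt (a i) i.1)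
    (hker : ∀ j < 2*k, Xpow k (θ j) + ∑ i : Fin (2*k), a i * Dpow i.1 (θ j) = 0)
    (h1i : (detSF (DmatSF (W1E N k θ))).Invertible)
    (h2i : (detSF (SchurE N k θ)).Invertible) :
    a ⟨2*k-2, by omega⟩ = -(sdetEHat N k θ * (sdetE N k θ).sinv) := by
  have he : ∀ j < k, (evenSeq θ j).IsEven := fun j hj => by
    have := hθp (2*j) (by omega); rwa [parityAt, if_pos (by omega)] at this
  have ho : ∀ j < k, (oddSeq θ j).IsOdd := fun j hj => by
    have := hθp (2*j+1) (by omega); rwa [parityAt, if_neg (by omega)] at this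
  have hW0 : ∀ i j, (W0E N k θ i j).IsEven := fun i j => X_even (he _ j.2) _
  have hW1 : ∀ i j, (W1E N k θ i j).IsOdd := fun i j => X_odd (ho _ j.2) _
  have hD0 : ∀ i j, (DmatSF (W0E N k θ) i j).IsOdd := fun i j => D_even (hW0 i j)
  have hD1 : ∀ i j, (DmatSF (W1E N k θ) i j).IsEven := fun i j => D_odd (hW1 i j)
  obtain ⟨M, hM⟩ := exists_co _ (fun i j => even_central (hD1 i j))
  obtain ⟨P, hP, hMP⟩ := inv_co M (hM ▸ h1i)
  have hMP' : co M * co P = 1 := by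
    rw [← co_mul, hMP]; exact Matrix.map_one _ (map_zero _) (map_one _)
  obtain ⟨S, hS⟩ := exists_co (SchurE N k θ) (fun i j => by
    refine Subring.sub_mem _ (even_central (hW0 i j)) ?_
    rw [hM, hP, Matrix.mul_apply]
    refine Subring.sum_mem _ fun l _ => ?_
    rw [Matrix.mul_apply, Finset.sum_mul]
    refine Subring.sum_mem _ fun l' _ => ?_
    have : W1E N k θ i l' * co P l' l * DmatSF (W0E N k θ) l j =
      co P l' l * (W1E N k θ i l' * DmatSF (W0E N k θ) l j) := by
      have hc : W1E N k θ i l' * co P l' l = co P l' l * W1E N k θ i l' :=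
        Subring.mem_center_iff.1 (P l' l).2 (W1E N k θ i l')
      rw [hc, mul_assoc]
    rw [this]
    exact Subring.mul_mem _ (P l' l).2 (even_central (odd_mul_odd (hW1 _ _) (hD0 _ _))))
  have hA0 : ∀ i : Fin k, a ⟨2 * i.1, by omega⟩ ∈ Z N := fun i => by
    have := hap ⟨2 * i.1, by omega⟩
    rw [parityAt, if_pos (by simp)] at this
    exact even_central this
  set A0 : Fin k → SF N := fun i => a ⟨2 * i.1, by omega⟩ with hA0d
  set A1 : Fin k → SF N := fun i => a ⟨2 * i.1 + 1, by omega⟩ with hA1d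
  have hk0 : (fun j : Fin k => Xpow k (evenSeq θ j.1)) +
      (A0 ᵥ* W0E N k θ + A1 ᵥ* DmatSF (W0E N k θ)) = 0 := by
    funext j
    have := hker (2 * j.1) (by omega)
    rw [sum_split] at this
    simp only [Dpow_even, Dpow_odd] at this
    exact this
  have hk1 : (fun j : Fin k => Xpow k (oddSeq θ j.1)) +
      (A0 ᵥ* W1E N k θ + A1 ᵥ* DmatSF (W1E N k θ)) = 0 := by
    funext j
    have := hker (2 * j.1 + 1) (by omega)
    rw [sum_split] at this
    simp only [Dpow_even, Dpow_odd] at this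
    exact this
  have hrow := row_calc A0 A1 _ _ _ _ _ _ (co P) hk0 hk1 (by rw [hM]; exact hMP')
  have hSd : W0E N k θ - W1E N k θ * co P * DmatSF (W0E N k θ) = co S := by
    rw [← hS, SchurE, hM, hP]
  rw [hSd] at hrow
  let A0' : Fin k → Z N := fun i => ⟨A0 i, hA0 i⟩
  let last : Fin k := ⟨k - 1, by omega⟩
  have hHat : SchurEHat N k θ = co (S.updateRow last (∑ l, (-A0' l) • S l)) := by
    refine funext fun i => ?_
    rw [SchurEHat, hM, hP, Matrix.mul_assoc]
    show WmatHat N k (evenSeq θ) i - (WmatHat N k (oddSeq θ) * (co P * DmatSF (W0E N k θ))) i = _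
    rw [Matrix.mul_apply_eq_vecMul]
    by_cases hi : i = last
    · subst hi
      have e : ∀ v : ℕ → SF N, WmatHat N k v last = fun j : Fin k => Xpow k (v j.1) := fun v => by
        funext j; simp [WmatHat, last]
      rw [e, e, hrow]
      funext j
      simp only [co, Matrix.map_apply, Matrix.updateRow_self, Finset.sum_apply, Pi.smul_apply,
        map_sum, smul_eq_mul, map_mul, map_neg, Pi.neg_apply, Matrix.vecMul, dotProduct, neg_mul,
        Finset.sum_neg_distrib]
      rfl
    · have e : ∀ v : ℕ → SF N, WmatHat N k v i = Wmat N k v i := fun v => by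
        funext j
        have : i.1 ≠ k - 1 := fun h => hi (Fin.ext h)
        simp [WmatHat, Wmat, this]
      rw [e, e]
      funext j
      simp only [co, Matrix.map_apply, Matrix.updateRow_ne hi]
      have := congrFun (congrFun hSd i) j
      rw [Matrix.mul_assoc] at this
      exact this
  have hdet : detSF (SchurEHat N k θ) = - a ⟨2*k-2, by omega⟩ * detSF (SchurE N k θ) := by
    have hl : A0 last = a ⟨2*k-2, by omega⟩ := by
      simp only [hA0d, last]; congr 2; omega
    rw [hHat, hS, det_co, det_co, Matrix.det_updateRow_sum, ← hl]
    rfl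
  have hE : (sdetE N k θ).Invertible := fun x t =>
    (h2i x t).mul (by
      show IsUnit (Ring.inverse _)
      exact (h1i x t).ringInverse)
  have : sdetEHat N k θ = - a ⟨2*k-2, by omega⟩ * sdetE N k θ := by
    rw [sdetEHat, hdet, sdetE, mul_assoc]
  rw [this, mul_assoc, mul_sinv hE, mul_one, neg_neg]

end SFProof

/-- in the even case `n = 2k`, `a_{2k−2} = −(sdet 𝒲̂)(sdet 𝒲)⁻¹`. -/
theorem statement_6 {N : ℕ} (hN : 1 ≤ N) (k : ℕ) (hk : 1 ≤ k) (θ : ℕ → SF N)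
    (hθs : ∀ j < 2*k, (θ j).Smooth) (hθp : ∀ j < 2*k, parityAt (θ j) j)
    (a : Fin (2*k) → SF N) (hap : ∀ i : Fin (2*k), parityAt (a i) i.1)
    (has : ∀ i : Fin (2*k), (a i).Smooth)
    (hker : ∀ j < 2*k, Xpow k (θ j) + ∑ i : Fin (2*k), a i * Dpow i.1 (θ j) = 0)
    (h1e : (detSF (DmatSF (W1E N k θ))).IsEven)
    (h1i : (detSF (DmatSF (W1E N k θ))).Invertible)
    (h2e : (detSF (SchurE N k θ)).IsEven)
    (h2i : (detSF (SchurE N k θ)).Invertible) :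
    a ⟨2*k-2, by omega⟩ = -(sdetEHat N k θ * (sdetE N k θ).sinv) := by
  exact SFProof.main k hk θ hθp a hap hker h1i h2i
end
end

section
/- In the even Wronskian setup with n = 2k, suppose the superfields a₀, …, a_{2k−1} solve the kernel system, and that det W^{(0)}, det DW^{(1)}, det(W^{(0)} − W^{(1)}(DW^{(1)})⁻¹DW^{(0)}) and det(DW^{(1)} − (DW^{(0)})(W^{(0)})⁻¹W^{(1)}) are invertible even superfields. Then a_{2k−1} = (D sdet 𝒲)·(sdet 𝒲)⁻¹, i.e. a_{2k−1} = D ln sdet 𝒲. -/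
noncomputable section
open scoped BigOperators

section AbstractPart

variable {n : Type*} [Fintype n] [DecidableEq n]

theorem deriv_prod_aux {R M ι : Type*} [CommRing R] [AddCommGroup M] [Module R M] [DecidableEq ι]
    (d : R → M) (h1 : d 1 = 0) (hm : ∀ a b, d (a * b) = a • d b + b • d a) (s : Finset ι) (f : ι → R) :
    d (∏ i ∈ s, f i) = ∑ i ∈ s, (∏ j ∈ s.erase i, f j) • d (f i) := by
  induction s using Finset.induction_on with
  | empty => simp [h1]
  | insert a s ha ih =>
    rw [Finset.prod_insert ha, hm, ih, Finset.sum_insert ha, Finset.erase_insert ha, Finset.smul_sum,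
      add_comm]
    congr 1
    refine Finset.sum_congr rfl fun i hi => ?_
    have hne : a ≠ i := by rintro rfl; exact ha hi
    rw [Finset.erase_insert_of_ne hne, Finset.prod_insert (by simp [ha]), smul_smul]

theorem jacobi_aux {R M : Type*} [CommRing R] [AddCommGroup M] [Module R M]
    (d : R →+ M) (hm : ∀ a b, d (a * b) = a • d b + b • d a) (A : Matrix n n R) :
    d A.det = ∑ i, ∑ j, A.adjugate j i • d (A i j) := by
  have h1 : d 1 = 0 := by
    have := hm 1 1
    simpa using this
  have hadj : ∀ i j, A.adjugate j i = ∑ σ : Equiv.Perm n, (Equiv.Perm.sign σ : ℤ) •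
      (if σ i = j then ∏ l ∈ Finset.univ.erase i, A l (σ l) else 0) := by
    intro i j
    rw [Matrix.adjugate_apply, ← Matrix.det_transpose, Matrix.det_apply]
    refine Finset.sum_congr rfl fun σ _ => ?_
    rw [Units.smul_def]
    congr 1
    rw [← Finset.mul_prod_erase _ _ (Finset.mem_univ i)]
    simp only [Matrix.transpose_apply, Matrix.updateRow_self]
    have : ∏ x ∈ Finset.univ.erase i, (A.updateRow i (Pi.single j 1)) x (σ x) 
        = ∏ l ∈ Finset.univ.erase i, A l (σ l) := by
      refine Finset.prod_congr rfl fun l hl => ?_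
      rw [Matrix.updateRow_ne (Finset.ne_of_mem_erase hl)]
    rw [this]
    by_cases h : σ i = j
    · subst h; simp
    · simp [h]
  rw [← Matrix.det_transpose, Matrix.det_apply, map_sum]
  have : ∀ σ : Equiv.Perm n, d (Equiv.Perm.sign σ • ∏ i, A.transpose (σ i) i) =
     ∑ i, ∑ j, ((Equiv.Perm.sign σ : ℤ) •
      (if σ i = j then ∏ l ∈ Finset.univ.erase i, A l (σ l) else 0)) • d (A i j) := by
    intro σ
    rw [Units.smul_def, map_zsmul, deriv_prod_aux d h1 hm, Finset.smul_sum]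
    refine Finset.sum_congr rfl fun i _ => ?_
    rw [Finset.sum_eq_single (σ i)]
    · rw [if_pos rfl, smul_assoc]; simp
    · intro b _ hb; simp [hb.symm]
    · simp
  simp_rw [this, hadj, Finset.sum_smul]
  rw [Finset.sum_comm]
  refine Finset.sum_congr rfl fun i _ => ?_
  rw [Finset.sum_comm]

variable {R A : Type*} [CommRing R] [Ring A] [Algebra R A]

theorem trace_comm_aux (X : Matrix n n R) (Y : Matrix n n A) :
    (X.map (algebraMap R A) * Y).trace = (Y * X.map (algebraMap R A)).trace := by
  simp only [Matrix.trace, Matrix.diag, Matrix.mul_apply, Matrix.map_apply]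
  rw [Finset.sum_comm]
  refine Finset.sum_congr rfl fun i _ => Finset.sum_congr rfl fun j _ => ?_
  rw [Algebra.commutes]

theorem abstract_sdet (D : A →+ A)
    (hD : ∀ (r : R) (x : A), D (algebraMap R A r * x) = D (algebraMap R A r) * x + algebraMap R A r * D x)
    (W0 E S K : Matrix n n R) (W1 L : Matrix n n A)
    (hW1 : ∀ i j y, D (W1 i j * y) = D (W1 i j) * y - W1 i j * D y)
    (hE : W1.map D = E.map (algebraMap R A))
    (hEu : IsUnit E.det) (hSu : IsUnit S.det)
    (hS : S.map (algebraMap R A) = W0.map (algebraMap R A) -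
      W1 * E⁻¹.map (algebraMap R A) * (W0.map (algebraMap R A)).map D)
    (h0 : ((W0.map (algebraMap R A)).map D).map D = 
      K.map (algebraMap R A) * W0.map (algebraMap R A) + L * (W0.map (algebraMap R A)).map D)
    (h1 : (W1.map D).map D = K.map (algebraMap R A) * W1 + L * E.map (algebraMap R A))
    (e : R) (he : E.det * e = 1) :
    D (algebraMap R A (S.det * e)) = - L.trace * algebraMap R A (S.det * e) := by
  set φ := algebraMap R A with hφ
  have hmapmul : ∀ X Y : Matrix n n R, (X * Y).map φ = X.map φ * Y.map φ := fun X Y => Matrix.map_mul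
  have hone : (1 : Matrix n n R).map φ = 1 := Matrix.map_one _ (map_zero φ) (map_one φ)
  have hD' : ∀ a b : R, D (φ (a * b)) = a • D (φ b) + b • D (φ a) := by
    intro a b
    rw [map_mul, hD, Algebra.smul_def, Algebra.smul_def, ← Algebra.commutes, add_comm]
  have jac : ∀ X : Matrix n n R, D (φ X.det) = (X.adjugate.map φ * (X.map φ).map D).trace := by
    intro X
    have := jacobi_aux (D.comp φ.toAddMonoidHom) hD' X
    simp only [AddMonoidHom.comp_apply, RingHom.toAddMonoidHom_eq_coe, AddMonoidHom.coe_coe] at this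
    rw [this, Finset.sum_comm]
    simp only [Matrix.trace, Matrix.diag, Matrix.mul_apply, Matrix.map_apply, Algebra.smul_def, hφ]
  have jac' : ∀ X : Matrix n n R, IsUnit X.det → 
      D (φ X.det) = φ X.det * (X⁻¹.map φ * (X.map φ).map D).trace := by
    intro X hX
    have : X.adjugate = X.det • X⁻¹ := by
      rw [Matrix.inv_def, smul_smul, Ring.mul_inverse_cancel _ hX, one_smul]
    rw [jac, this, Matrix.map_smul' _ _ _ (fun a b => map_mul φ a b), Matrix.smul_mul, Matrix.trace_smul, smul_eq_mul]
  -- matrix Leibniz rules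
  have ml1 : ∀ (X : Matrix n n R) (Y : Matrix n n A), (X.map φ * Y).map D =
      (X.map φ).map D * Y + X.map φ * Y.map D := by
    intro X Y
    ext i j
    simp [Matrix.mul_apply, hD, Finset.sum_add_distrib]
  have ml2 : ∀ (Y : Matrix n n A), (W1 * Y).map D = W1.map D * Y - W1 * Y.map D := by
    intro Y
    ext i j
    simp [Matrix.mul_apply, hW1, Finset.sum_sub_distrib]
  have hD1 : D 1 = 0 := by
    have := hD 1 1
    simpa using this
  have EE : E.map φ * E⁻¹.map φ = 1 := by rw [← hmapmul, Matrix.mul_nonsing_inv _ hEu, hone]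
  have EE' : E⁻¹.map φ * E.map φ = 1 := by rw [← hmapmul, Matrix.nonsing_inv_mul _ hEu, hone]
  have SS : S.map φ * S⁻¹.map φ = 1 := by rw [← hmapmul, Matrix.mul_nonsing_inv _ hSu, hone]
  have hDE : (E.map φ).map D = K.map φ * W1 + L * E.map φ := by rw [← hE, h1, hE]
  set C := (W0.map φ).map D with hC
  set F := E⁻¹.map φ with hF
  have hDF : F.map D = - (F * (E.map φ).map D * F) := by
    have h := ml1 E⁻¹ (E.map φ)
    rw [← hF, EE'] at h
    have h10 : (1 : Matrix n n A).map D = 0 := by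
      ext i j
      by_cases hij : i = j
      · subst hij; simp [hD1]
      · simp [hij]
    rw [h10] at h
    have h2 : F.map D * E.map φ = - (F * (E.map φ).map D) := eq_neg_of_add_eq_zero_left h.symm
    calc F.map D = F.map D * E.map φ * F := by rw [mul_assoc, EE, mul_one]
      _ = _ := by rw [h2, neg_mul]
  have hDS : (S.map φ).map D = W1 * F * K.map φ * S.map φ := by
    have e1 : (S.map φ).map D = C - (W1 * (F * C)).map D := by
      rw [hS, mul_assoc]
      ext i j
      simp [hC]
    rw [e1, ml2, hE, hF, ml1, ← hF, hDF, h0, hDE, hS, ← mul_assoc (E.map φ), EE, one_mul]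
    have : F * (K.map φ * W1 + L * E.map φ) * F = F * K.map φ * W1 * F + F * L := by
      rw [mul_add, add_mul]
      congr 1
      · simp only [mul_assoc]
      · rw [mul_assoc, mul_assoc, EE, mul_one]
    rw [this]
    noncomm_ring
  have t1 : D (φ S.det) = φ S.det * (W1 * F * K.map φ).trace := by
    rw [jac' S hSu, hDS, trace_comm_aux, mul_assoc, SS, mul_one]
  have t2 : D (φ E.det) = φ E.det * ((W1 * F * K.map φ).trace + L.trace) := by
    rw [jac' E hEu, hDE, mul_add, Matrix.trace_add, ← hF, hF, trace_comm_aux E⁻¹ (L * E.map φ), mul_assoc L, ← hF, EE, mul_one,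
      ← mul_assoc, hF, ← hmapmul, trace_comm_aux, hmapmul, mul_assoc]
  have t3 : D (φ e) = - φ e * ((W1 * F * K.map φ).trace + L.trace) := by
    have h := hD E.det (φ e)
    rw [← map_mul, he, map_one, hD1, t2] at h
    have he' : φ e * φ E.det = 1 := by rw [← map_mul, mul_comm, he, map_one]
    have h3 : φ E.det * D (φ e) = - (φ E.det * ((W1 * F * K.map φ).trace + L.trace) * φ e) :=
      eq_neg_of_add_eq_zero_right h.symm
    calc D (φ e) = φ e * (φ E.det * D (φ e)) := by rw [← mul_assoc, he', one_mul]
      _ = - (φ e * φ E.det * ((W1 * F * K.map φ).trace + L.trace) * φ e) := by rw [h3]; noncomm_ring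
      _ = _ := by rw [he', one_mul, ← Algebra.commutes, neg_mul]
  rw [map_mul, hD, t1, t3]
  have c1 : ∀ x, φ e * x = x * φ e := fun x => Algebra.commutes (A := A) e x
  have c2 : ∀ x, φ S.det * x = x * φ S.det := fun x => Algebra.commutes (A := A) S.det x
  rw [← c1 (φ S.det), ← mul_assoc (-L.trace), ← c1 (-L.trace), mul_assoc (φ e), ← c2 (-L.trace),
    ← c1 (φ S.det * _), neg_mul, mul_neg, ← mul_assoc (φ S.det) (φ e), ← c1 (φ S.det)]
  noncomm_ring

end AbstractPart

section ConcretePart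
variable {N : ℕ}

theorem SF.ext' {f g : SF N} (h0 : ∀ x t, f.c0 x t = g.c0 x t) (h1 : ∀ x t, f.c1 x t = g.c1 x t) : f = g :=
  SF.ext (funext fun x => funext fun t => h0 x t) (funext fun x => funext fun t => h1 x t)

theorem SF.zero_c0 (x t) : (0 : SF N).c0 x t = 0 := rfl
theorem SF.zero_c1 (x t) : (0 : SF N).c1 x t = 0 := rfl
theorem SF.one_c0 (x t) : (1 : SF N).c0 x t = 1 := rfl
theorem SF.one_c1 (x t) : (1 : SF N).c1 x t = 0 := rfl
theorem SF.add_c0 (f g : SF N) (x t) : (f + g).c0 x t = f.c0 x t + g.c0 x t := rfl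
theorem SF.add_c1 (f g : SF N) (x t) : (f + g).c1 x t = f.c1 x t + g.c1 x t := rfl
theorem SF.neg_c0 (f : SF N) (x t) : (-f).c0 x t = -f.c0 x t := rfl
theorem SF.neg_c1 (f : SF N) (x t) : (-f).c1 x t = -f.c1 x t := rfl
theorem SF.mul_c0 (f g : SF N) (x t) : (f * g).c0 x t = f.c0 x t * g.c0 x t := rfl
theorem SF.mul_c1 (f g : SF N) (x t) : (f * g).c1 x t =
   f.c1 x t * g.c0 x t + CliffordAlgebra.involute (f.c0 x t) * g.c1 x t := rfl

abbrev SF.instRing (N : ℕ) : Ring (SF N) :=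
  { (inferInstance : AddCommGroup (SF N)), (inferInstance : Mul (SF N)), (inferInstance : One (SF N)) with
    left_distrib := fun a b c => by
      apply SF.ext' <;> intro x t <;> simp only [SF.mul_c0, SF.mul_c1, SF.add_c0, SF.add_c1] <;> noncomm_ring
    right_distrib := fun a b c => by
      apply SF.ext' <;> intro x t <;> simp only [SF.mul_c0, SF.mul_c1, SF.add_c0, SF.add_c1, map_add] <;> noncomm_ring
    zero_mul := fun a => by
      apply SF.ext' <;> intro x t <;> simp [SF.mul_c0, SF.mul_c1, SF.zero_c0, SF.zero_c1]
    mul_zero := fun a => by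
      apply SF.ext' <;> intro x t <;> simp [SF.mul_c0, SF.mul_c1, SF.zero_c0, SF.zero_c1]
    one_mul := fun a => by
      apply SF.ext' <;> intro x t <;> simp [SF.mul_c0, SF.mul_c1, SF.one_c0, SF.one_c1]
    mul_one := fun a => by
      apply SF.ext' <;> intro x t <;> simp [SF.mul_c0, SF.mul_c1, SF.one_c0, SF.one_c1]
    mul_assoc := fun a b c => by
      apply SF.ext' <;> intro x t <;> simp only [SF.mul_c0, SF.mul_c1, map_mul] <;> noncomm_ring }

attribute [local instance] SF.instRing

instance : Module.Finite ℝ (SuperAlg N) :=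
  Module.Finite.of_basis (Module.Basis.ExteriorAlgebra (Pi.basisFun ℝ (Fin N)))

section norm
attribute [local instance] Matrix.linftyOpNormedRing Matrix.linftyOpNormedAlgebra

abbrev LamNR (N : ℕ) : NormedRing (SuperAlg N) :=
  NormedRing.induced (SuperAlg N) (Matrix (Finset (Fin N)) (Finset (Fin N)) ℝ)
    (Algebra.leftMulMatrix (Module.Basis.ExteriorAlgebra (Pi.basisFun ℝ (Fin N))))
    (Algebra.leftMulMatrix_injective _)
attribute [local instance] LamNR
abbrev LamNA (N : ℕ) : NormedAlgebra ℝ (SuperAlg N) :=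
  NormedAlgebra.induced ℝ (SuperAlg N) (Matrix (Finset (Fin N)) (Finset (Fin N)) ℝ)
    (Algebra.leftMulMatrix (Module.Basis.ExteriorAlgebra (Pi.basisFun ℝ (Fin N))))
end norm
attribute [local instance] LamNR LamNA

instance : CompleteSpace (SuperAlg N) := FiniteDimensional.complete ℝ _

theorem smoothLam_iff {g : ℝ → ℝ → SuperAlg N} :
    SmoothLam g ↔ ContDiff ℝ (⊤ : ℕ∞) (fun p : ℝ × ℝ => g p.1 p.2) := by
  constructor
  · intro h
    let b := Module.finBasis ℝ (SuperAlg N)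
    have : (fun p : ℝ × ℝ => g p.1 p.2) = fun p => ∑ i, (b.coord i (g p.1 p.2)) • b i := by
      funext p; exact (b.sum_repr _).symm
    rw [this]
    exact ContDiff.sum fun i _ => (h (b.coord i)).smul contDiff_const
  · intro h l
    exact (LinearMap.toContinuousLinearMap l).contDiff.comp h

theorem derLam_eq {g : ℝ → SuperAlg N} {x : ℝ} {d : SuperAlg N} (h : HasDerivAt g d x) :
    derLam g x = d := by
  have h1 : ∃ d : SuperAlg N, ∀ l : SuperAlg N →ₗ[ℝ] ℝ,
      HasDerivAt (fun y => l (g y)) (l d) x :=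
    ⟨d, fun l => (LinearMap.toContinuousLinearMap l).hasFDerivAt.comp_hasDerivAt x h⟩
  unfold derLam
  rw [dif_pos h1]
  have h2 := h1.choose_spec
  set d' := h1.choose
  let b := Module.finBasis ℝ (SuperAlg N)
  refine b.ext_elem fun i => ?_
  have h3 := (LinearMap.toContinuousLinearMap (b.coord i)).hasFDerivAt.comp_hasDerivAt x h
  exact (h2 (b.coord i)).unique h3

theorem SmoothLam.hasDerivAt {g : ℝ → ℝ → SuperAlg N} (h : SmoothLam g) (x t : ℝ) :
    HasDerivAt (fun y => g y t) (derLam (fun y => g y t) x) x := by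
  have h' := smoothLam_iff.1 h
  have : DifferentiableAt ℝ (fun y => g y t) x := by
    have h2 : ContDiff ℝ (⊤ : ℕ∞) (fun y : ℝ => g y t) :=
      h'.comp (contDiff_id.prodMk contDiff_const)
    exact (h2.differentiable (by simp)).differentiableAt
  have h3 := this.hasDerivAt
  rwa [derLam_eq h3]

theorem SmoothLam.derLam {g : ℝ → ℝ → SuperAlg N} (h : SmoothLam g) :
    SmoothLam (fun x t => derLam (fun y => g y t) x) := by
  have h' := smoothLam_iff.1 h
  rw [smoothLam_iff]
  have : (fun p : ℝ × ℝ => _root_.derLam (fun y => g y p.2) p.1) =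
      fun p => fderiv ℝ (fun p : ℝ × ℝ => g p.1 p.2) p (1, 0) := by
    funext p
    apply derLam_eq
    have h1 := (h'.differentiable (by simp)).differentiableAt (x := p) |>.hasFDerivAt
    have h2 : HasDerivAt (fun y : ℝ => (y, p.2)) ((1 : ℝ), (0 : ℝ)) p.1 :=
      (hasDerivAt_id p.1).prodMk (hasDerivAt_const _ _)
    exact h1.comp_hasDerivAt (x := p.1) (f := fun y : ℝ => (y, p.2)) h2
  rw [this]
  exact (h'.fderiv_right (by simp)).clm_apply contDiff_const

theorem SmoothLam.linear {g : ℝ → ℝ → SuperAlg N} (h : SmoothLam g) (T : SuperAlg N →ₗ[ℝ] SuperAlg N) :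
    SmoothLam (fun x t => T (g x t)) := fun l => h (l.comp T)

theorem SmoothLam.mul {f g : ℝ → ℝ → SuperAlg N} (hf : SmoothLam f) (hg : SmoothLam g) :
    SmoothLam (fun x t => f x t * g x t) :=
  smoothLam_iff.2 ((smoothLam_iff.1 hf).mul (smoothLam_iff.1 hg))

theorem SmoothLam.add {f g : ℝ → ℝ → SuperAlg N} (hf : SmoothLam f) (hg : SmoothLam g) :
    SmoothLam (fun x t => f x t + g x t) :=
  smoothLam_iff.2 ((smoothLam_iff.1 hf).add (smoothLam_iff.1 hg))

theorem SmoothLam.neg {f : ℝ → ℝ → SuperAlg N} (hf : SmoothLam f) :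
    SmoothLam (fun x t => - f x t) :=
  smoothLam_iff.2 ((smoothLam_iff.1 hf).neg)

theorem SmoothLam.const (c : SuperAlg N) : SmoothLam (fun _ _ => c) :=
  smoothLam_iff.2 contDiff_const

theorem SmoothLam.inverse {f : ℝ → ℝ → SuperAlg N} (hf : SmoothLam f) (hu : ∀ x t, IsUnit (f x t)) :
    SmoothLam (fun x t => Ring.inverse (f x t)) := by
  rw [smoothLam_iff] at *
  rw [contDiff_iff_contDiffAt]
  intro p
  obtain ⟨u, hu⟩ := hu p.1 p.2
  have := contDiffAt_ringInverse ℝ u (n := (⊤ : ℕ∞))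
  rw [hu] at this
  exact this.comp p hf.contDiffAt

theorem derLam_add {f g : ℝ → ℝ → SuperAlg N} (hf : SmoothLam f) (hg : SmoothLam g) (x t) :
    derLam (fun y => f y t + g y t) x = derLam (fun y => f y t) x + derLam (fun y => g y t) x :=
  derLam_eq ((hf.hasDerivAt x t).add (hg.hasDerivAt x t))

theorem derLam_mul {f g : ℝ → ℝ → SuperAlg N} (hf : SmoothLam f) (hg : SmoothLam g) (x t) :
    derLam (fun y => f y t * g y t) x =
      derLam (fun y => f y t) x * g x t + f x t * derLam (fun y => g y t) x :=
  derLam_eq ((hf.hasDerivAt x t).mul (hg.hasDerivAt x t))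

theorem derLam_linear {f : ℝ → ℝ → SuperAlg N} (hf : SmoothLam f) (T : SuperAlg N →ₗ[ℝ] SuperAlg N) (x t) :
    derLam (fun y => T (f y t)) x = T (derLam (fun y => f y t) x) :=
  derLam_eq ((LinearMap.toContinuousLinearMap T).hasFDerivAt.comp_hasDerivAt x (hf.hasDerivAt x t))


def EvEl (x : SuperAlg N) : Prop := CliffordAlgebra.involute x = x ∧ ∀ g, x * g = g * x
def OdEl (x : SuperAlg N) : Prop :=
  CliffordAlgebra.involute x = -x ∧ ∀ g, x * g = CliffordAlgebra.involute g * x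

theorem EvEl.one : EvEl (1 : SuperAlg N) := ⟨map_one _, fun g => by simp⟩
theorem EvEl.zero : EvEl (0 : SuperAlg N) := ⟨map_zero _, fun g => by simp⟩
theorem OdEl.zero : OdEl (0 : SuperAlg N) := ⟨by simp, fun g => by simp⟩
theorem EvEl.add {x y : SuperAlg N} (hx : EvEl x) (hy : EvEl y) : EvEl (x + y) :=
  ⟨by rw [map_add, hx.1, hy.1], fun g => by rw [add_mul, hx.2, hy.2, mul_add]⟩
theorem OdEl.add {x y : SuperAlg N} (hx : OdEl x) (hy : OdEl y) : OdEl (x + y) :=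
  ⟨by rw [map_add, hx.1, hy.1]; abel, fun g => by rw [add_mul, hx.2, hy.2, mul_add]⟩
theorem EvEl.neg {x : SuperAlg N} (hx : EvEl x) : EvEl (-x) :=
  ⟨by rw [map_neg, hx.1], fun g => by rw [neg_mul, hx.2, mul_neg]⟩
theorem OdEl.neg {x : SuperAlg N} (hx : OdEl x) : OdEl (-x) :=
  ⟨by rw [map_neg, hx.1], fun g => by rw [neg_mul, hx.2, mul_neg]⟩
theorem EvEl.mul {x y : SuperAlg N} (hx : EvEl x) (hy : EvEl y) : EvEl (x * y) :=
  ⟨by rw [map_mul, hx.1, hy.1], fun g => by rw [mul_assoc, hy.2, ← mul_assoc, hx.2, mul_assoc]⟩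
theorem EvEl.mul_od {x y : SuperAlg N} (hx : EvEl x) (hy : OdEl y) : OdEl (x * y) :=
  ⟨by rw [map_mul, hx.1, hy.1, mul_neg], fun g => by rw [mul_assoc, hy.2, ← mul_assoc, hx.2, mul_assoc]⟩
theorem OdEl.mul_ev {x y : SuperAlg N} (hx : OdEl x) (hy : EvEl y) : OdEl (x * y) := by
  rw [← hy.2]; exact hy.mul_od hx
theorem OdEl.mul {x y : SuperAlg N} (hx : OdEl x) (hy : OdEl y) : EvEl (x * y) :=
  ⟨by rw [map_mul, hx.1, hy.1, neg_mul_neg], fun g => by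
    rw [mul_assoc, hy.2, ← mul_assoc, hx.2, mul_assoc, CliffordAlgebra.involute_involute]⟩

theorem isUnit_involute {x : SuperAlg N} (h : IsUnit x) :
    IsUnit (CliffordAlgebra.involute x) := h.map _

theorem EvEl.inverse {x : SuperAlg N} (hx : EvEl x) (hu : IsUnit x) : EvEl (Ring.inverse x) := by
  have h1 := Ring.mul_inverse_cancel x hu
  have h2 := Ring.inverse_mul_cancel x hu
  constructor
  · have h3 : x * CliffordAlgebra.involute (Ring.inverse x) = 1 := by
      have h4 := congrArg CliffordAlgebra.involute h1
      rwa [map_mul, hx.1, map_one] at h4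
    exact hu.mul_left_cancel (h3.trans h1.symm)
  · intro g
    apply hu.mul_left_cancel
    rw [← mul_assoc, h1, one_mul, ← mul_assoc, hx.2 g, mul_assoc, h1, mul_one]

theorem OdEl.ι (v : Fin N → ℝ) : OdEl (ExteriorAlgebra.ι ℝ v : SuperAlg N) := by
  constructor
  · exact CliffordAlgebra.involute_ι v
  · intro g
    induction g using ExteriorAlgebra.induction with
    | algebraMap r => rw [AlgHom.commutes, Algebra.commutes]
    | ι w =>
      have : CliffordAlgebra.involute (ExteriorAlgebra.ι ℝ w : SuperAlg N) = - ExteriorAlgebra.ι ℝ w :=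
        CliffordAlgebra.involute_ι w
      rw [this, neg_mul, eq_neg_iff_add_eq_zero]
      exact ExteriorAlgebra.ι_add_mul_swap v w
    | mul a b ha hb => rw [map_mul, ← mul_assoc, ha, mul_assoc, hb, mul_assoc]
    | add a b ha hb => rw [map_add, mul_add, ha, hb, add_mul]

theorem EvEl.of_mem {x : SuperAlg N} (h : x ∈ LambdaEven N) : EvEl x := by
  unfold LambdaEven at h
  induction x, h using CliffordAlgebra.even_induction with
  | algebraMap r => exact ⟨AlgHom.commutes _ _, fun g => Algebra.commutes _ _⟩
  | add x y hx hy ihx ihy => exact ihx.add ihy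
  | ι_mul_ι_mul m₁ m₂ x hx ih => exact ((OdEl.ι m₁).mul (OdEl.ι m₂)).mul ih

theorem OdEl.of_mem {x : SuperAlg N} (h : x ∈ LambdaOdd N) : OdEl x := by
  unfold LambdaOdd at h
  induction x, h using CliffordAlgebra.odd_induction with
  | ι v => exact OdEl.ι v
  | add x y hx hy ihx ihy => exact ihx.add ihy
  | ι_mul_ι_mul m₁ m₂ x hx ih => exact ((OdEl.ι m₁).mul (OdEl.ι m₂)).mul_od ih

theorem EvEl.derLam {g : ℝ → ℝ → SuperAlg N} (hg : SmoothLam g) (h : ∀ x t, EvEl (g x t)) (x t) :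
    EvEl (derLam (fun y => g y t) x) := by
  constructor
  · have := derLam_linear hg (CliffordAlgebra.involute (Q := (0 : QuadraticForm ℝ (Fin N → ℝ)))).toLinearMap x t
    simp only [AlgHom.toLinearMap_apply] at this
    rw [← this]; simp only [(h _ _).1]
  · intro c
    have h1 := derLam_linear hg (LinearMap.mulLeft ℝ c) x t
    have h2 := derLam_linear hg (LinearMap.mulRight ℝ c) x t
    simp only [LinearMap.mulLeft_apply, LinearMap.mulRight_apply, (h _ _).2 c] at h1 h2
    rw [← h1, ← h2]

theorem OdEl.derLam {g : ℝ → ℝ → SuperAlg N} (hg : SmoothLam g) (h : ∀ x t, OdEl (g x t)) (x t) :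
    OdEl (derLam (fun y => g y t) x) := by
  constructor
  · have := derLam_linear hg (CliffordAlgebra.involute (Q := (0 : QuadraticForm ℝ (Fin N → ℝ)))).toLinearMap x t
    have h3 := derLam_linear hg (-LinearMap.id) x t
    simp only [AlgHom.toLinearMap_apply, LinearMap.neg_apply, LinearMap.id_apply] at this h3
    rw [← this, ← h3]; simp only [(h _ _).1]
  · intro c
    have h1 := derLam_linear hg (LinearMap.mulLeft ℝ (CliffordAlgebra.involute c)) x t
    have h2 := derLam_linear hg (LinearMap.mulRight ℝ c) x t
    simp only [LinearMap.mulLeft_apply, LinearMap.mulRight_apply, (h _ _).2 c] at h1 h2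
    rw [← h1, ← h2]

namespace SF

theorem Smooth.mul {f g : SF N} (hf : f.Smooth) (hg : g.Smooth) : (f * g).Smooth :=
  ⟨hf.1.mul hg.1, (hf.2.mul hg.1).add ((hf.1.linear (CliffordAlgebra.involute
    (Q := (0 : QuadraticForm ℝ (Fin N → ℝ)))).toLinearMap).mul hg.2)⟩

theorem Smooth.Dsd {f : SF N} (hf : f.Smooth) : f.Dsd.Smooth := ⟨hf.2, hf.1.derLam⟩
theorem Smooth.dx {f : SF N} (hf : f.Smooth) : f.dx.Smooth := ⟨hf.1.derLam, hf.2.derLam⟩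
theorem Smooth.Xpow {f : SF N} (hf : f.Smooth) (m : ℕ) : (Xpow m f).Smooth := by
  induction m with
  | zero => exact hf
  | succ m ih => exact ih.dx

/-- weak evenness -/
def Ev (f : SF N) : Prop := (∀ x t, EvEl (f.c0 x t)) ∧ (∀ x t, OdEl (f.c1 x t))
def Od (f : SF N) : Prop := (∀ x t, OdEl (f.c0 x t)) ∧ (∀ x t, EvEl (f.c1 x t))

theorem IsEven.ev {f : SF N} (h : f.IsEven) : f.Ev :=
  ⟨fun x t => EvEl.of_mem (h.1 x t), fun x t => OdEl.of_mem (h.2 x t)⟩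
theorem IsOdd.od {f : SF N} (h : f.IsOdd) : f.Od :=
  ⟨fun x t => OdEl.of_mem (h.1 x t), fun x t => EvEl.of_mem (h.2 x t)⟩

theorem Ev.mul {f g : SF N} (hf : f.Ev) (hg : g.Ev) : (f * g).Ev :=
  ⟨fun x t => (hf.1 x t).mul (hg.1 x t), fun x t => by
    rw [mul_c1, (hf.1 x t).1]
    exact ((hf.2 x t).mul_ev (hg.1 x t)).add ((hf.1 x t).mul_od (hg.2 x t))⟩
theorem Od.mul_ev {f g : SF N} (hf : f.Od) (hg : g.Ev) : (f * g).Od :=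
  ⟨fun x t => (hf.1 x t).mul_ev (hg.1 x t), fun x t => by
    rw [mul_c1, (hf.1 x t).1]
    exact ((hf.2 x t).mul (hg.1 x t)).add ((hf.1 x t).neg.mul (hg.2 x t))⟩
theorem Od.mul {f g : SF N} (hf : f.Od) (hg : g.Od) : (f * g).Ev :=
  ⟨fun x t => (hf.1 x t).mul (hg.1 x t), fun x t => by
    rw [mul_c1, (hf.1 x t).1]
    exact ((hf.2 x t).mul_od (hg.1 x t)).add ((hf.1 x t).neg.mul_ev (hg.2 x t))⟩
theorem Od.zero : (0 : SF N).Od := ⟨fun _ _ => OdEl.zero, fun _ _ => EvEl.zero⟩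
theorem Od.add {f g : SF N} (hf : f.Od) (hg : g.Od) : (f + g).Od :=
  ⟨fun x t => (hf.1 x t).add (hg.1 x t), fun x t => (hf.2 x t).add (hg.2 x t)⟩
theorem Od.sum {ι : Type*} (s : Finset ι) (f : ι → SF N) (h : ∀ i, (f i).Od) : (∑ i ∈ s, f i).Od := by
  classical
  induction s using Finset.induction_on with
  | empty => exact Od.zero
  | insert a s ha ih => rw [Finset.sum_insert ha]; exact (h a).add ih

theorem Ev.dx {f : SF N} (hf : f.Ev) (hs : f.Smooth) : f.dx.Ev :=
  ⟨fun x t => EvEl.derLam hs.1 hf.1 x t, fun x t => OdEl.derLam hs.2 hf.2 x t⟩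
theorem Od.dx {f : SF N} (hf : f.Od) (hs : f.Smooth) : f.dx.Od :=
  ⟨fun x t => OdEl.derLam hs.1 hf.1 x t, fun x t => EvEl.derLam hs.2 hf.2 x t⟩
theorem Ev.Dsd {f : SF N} (hf : f.Ev) (hs : f.Smooth) : f.Dsd.Od :=
  ⟨hf.2, fun x t => EvEl.derLam hs.1 hf.1 x t⟩
theorem Od.Dsd {f : SF N} (hf : f.Od) (hs : f.Smooth) : f.Dsd.Ev :=
  ⟨hf.2, fun x t => OdEl.derLam hs.1 hf.1 x t⟩
theorem Ev.Xpow {f : SF N} (hf : f.Ev) (hs : f.Smooth) (m : ℕ) : (Xpow m f).Ev := by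
  induction m with
  | zero => exact hf
  | succ m ih => exact ih.dx (hs.Xpow m)
theorem Od.Xpow {f : SF N} (hf : f.Od) (hs : f.Smooth) (m : ℕ) : (Xpow m f).Od := by
  induction m with
  | zero => exact hf
  | succ m ih => exact ih.dx (hs.Xpow m)

theorem Ev.comm {f : SF N} (hf : f.Ev) (g : SF N) : f * g = g * f := by
  apply SF.ext' <;> intro x t
  · exact (hf.1 x t).2 _
  · rw [mul_c1, mul_c1, (hf.1 x t).1, (hf.1 x t).2, (hf.2 x t).2, add_comm]

theorem Ev.leibniz {f g : SF N} (hf : f.Ev) (hs : f.Smooth) (hg : g.Smooth) :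
    (f * g).Dsd = f.Dsd * g + f * g.Dsd := by
  apply SF.ext' <;> intro x t
  · simp only [SF.Dsd, mul_c0, mul_c1, add_c0, (hf.1 x t).1]
  · simp only [SF.Dsd, mul_c0, mul_c1, add_c1, (hf.1 x t).1, (hf.2 x t).1, derLam_mul hs.1 hg.1]
    noncomm_ring

theorem Od.leibniz {f g : SF N} (hf : f.Od) (hs : f.Smooth) (hg : g.Smooth) :
    (f * g).Dsd = f.Dsd * g - f * g.Dsd := by
  rw [sub_eq_add_neg]
  apply SF.ext' <;> intro x t
  · simp only [SF.Dsd, mul_c0, mul_c1, add_c0, neg_c0, (hf.1 x t).1]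
    noncomm_ring
  · simp only [SF.Dsd, mul_c0, mul_c1, add_c1, neg_c1, (hf.1 x t).1, (hf.2 x t).1, derLam_mul hs.1 hg.1]
    noncomm_ring

theorem Dsd_add {f g : SF N} (hs : f.Smooth) (hg : g.Smooth) : (f + g).Dsd = f.Dsd + g.Dsd := by
  apply SF.ext' <;> intro x t
  · rfl
  · exact derLam_add hs.1 hg.1 x t

theorem mul_sinv {f : SF N} (hi : f.Invertible) : f * f.sinv = 1 := by
  apply SF.ext' <;> intro x t
  · exact Ring.mul_inverse_cancel _ (hi x t)
  · simp only [sinv, mul_c1, one_c1]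
    rw [mul_neg, mul_assoc (Ring.inverse _), ← mul_assoc, Ring.mul_inverse_cancel _ (isUnit_involute (hi x t)), one_mul,
      add_neg_cancel]

theorem Ev.sinv {f : SF N} (hf : f.Ev) (hi : f.Invertible) : f.sinv.Ev := by
  refine ⟨fun x t => (hf.1 x t).inverse (hi x t), fun x t => ?_⟩
  have := (hf.1 x t).inverse (hi x t)
  simp only [SF.sinv, (hf.1 x t).1]
  exact ((this.mul_od (hf.2 x t)).mul_ev this).neg

theorem Smooth.sinv {f : SF N} (hf : f.Smooth) (hi : f.Invertible) : f.sinv.Smooth :=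
  ⟨hf.1.inverse hi, ((((hf.1.linear (CliffordAlgebra.involute
    (Q := (0 : QuadraticForm ℝ (Fin N → ℝ)))).toLinearMap).inverse
      (fun x t => isUnit_involute (hi x t))).mul hf.2).mul (hf.1.inverse hi)).neg⟩

end SF

/-- smooth superfields -/
def SmR (N : ℕ) : Subring (SF N) where
  carrier := {f | f.Smooth}
  mul_mem' := fun ha hb => SF.Smooth.mul ha hb
  one_mem' := ⟨SmoothLam.const 1, SmoothLam.const 0⟩
  add_mem' := fun ha hb => ⟨ha.1.add hb.1, ha.2.add hb.2⟩
  zero_mem' := ⟨SmoothLam.const 0, SmoothLam.const 0⟩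
  neg_mem' := fun ha => ⟨ha.1.neg, ha.2.neg⟩

/-- smooth even superfields -/
def EvR (N : ℕ) : Subring (SF N) where
  carrier := {f | f.Smooth ∧ f.Ev}
  mul_mem' := fun ha hb => ⟨SF.Smooth.mul ha.1 hb.1, ha.2.mul hb.2⟩
  one_mem' := ⟨(SmR N).one_mem, fun _ _ => EvEl.one, fun _ _ => OdEl.zero⟩
  add_mem' := fun ha hb => ⟨(SmR N).add_mem ha.1 hb.1,
    fun x t => (ha.2.1 x t).add (hb.2.1 x t), fun x t => (ha.2.2 x t).add (hb.2.2 x t)⟩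
  zero_mem' := ⟨(SmR N).zero_mem, fun _ _ => EvEl.zero, fun _ _ => OdEl.zero⟩
  neg_mem' := fun ha => ⟨(SmR N).neg_mem ha.1,
    fun x t => (ha.2.1 x t).neg, fun x t => (ha.2.2 x t).neg⟩

instance EvR.instCommRing : CommRing (EvR N) :=
  { (inferInstance : Ring (EvR N)) with
    mul_comm := fun a b => Subtype.ext (a.2.2.comm b.1) }

theorem EvR_le : EvR N ≤ SmR N := fun _ h => h.1

instance EvR.instAlgebra : Algebra (EvR N) (SmR N) :=
  RingHom.toAlgebra' (Subring.inclusion EvR_le) (fun c x => Subtype.ext (c.2.2.comm x.1))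

theorem algMap_coe (r : EvR N) : ((algebraMap (EvR N) (SmR N) r : SmR N) : SF N) = r := rfl

/-- `D` on smooth superfields -/
def DHom (N : ℕ) : SmR N →+ SmR N :=
  AddMonoidHom.mk' (fun f => ⟨f.1.Dsd, SF.Smooth.Dsd f.2⟩)
    (fun f g => Subtype.ext (SF.Dsd_add f.2 g.2))

theorem DHom_coe (f : SmR N) : ((DHom N f : SmR N) : SF N) = f.1.Dsd := rfl

theorem detSF_coe {k : ℕ} (M : Matrix (Fin k) (Fin k) (EvR N)) :
    detSF (M.map (fun r => (r : SF N))) = (M.det : EvR N) := by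
  rw [← Matrix.det_transpose, Matrix.det_apply]
  unfold detSF
  change _ = (EvR N).subtype _
  rw [map_sum]
  refine Finset.sum_congr rfl fun σ _ => ?_
  rw [Units.smul_def, map_zsmul, Fin.prod_univ_def, map_list_prod, List.map_map]
  rfl

theorem adjSF_coe {k : ℕ} (M : Matrix (Fin k) (Fin k) (EvR N)) :
    adjSF (M.map (fun r => (r : SF N))) = M.adjugate.map (fun r => (r : SF N)) := by
  cases k with
  | zero => exact Matrix.ext fun i => i.elim0
  | succ m =>
    have hdrop : ∀ j : Fin (m + 1), (dropIdx j : Fin m → Fin (m+1)) = j.succAbove := by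
      intro j; funext i
      apply Fin.ext
      simp only [dropIdx, Fin.succAbove, Fin.lt_def]
      by_cases h : i.1 < j.1
      · rw [if_pos h, if_pos (show (Fin.castSucc (n := m) i).1 < j.1 from h)]; rfl
      · rw [if_neg h, if_neg (show ¬ (Fin.castSucc (n := m) i).1 < j.1 from h)]; rfl
    refine Matrix.ext fun i j => ?_
    have h1 : minorSF (M.map (fun r => (r : SF N))) j i =
        (M.submatrix j.succAbove i.succAbove).map (fun r => (r : SF N)) := by
      unfold minorSF
      rw [hdrop, hdrop]
      rfl
    simp only [adjSF, Matrix.of_apply, Matrix.map_apply]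
    rw [h1]
    have h2 := detSF_coe (M.submatrix j.succAbove i.succAbove)
    refine (congrArg _ h2).trans ?_
    rw [Matrix.adjugate_fin_succ_eq_det_submatrix, add_comm (j : ℕ)]
    change _ = (EvR N).subtype ((-1) ^ (i.1 + j.1) * (M.submatrix j.succAbove i.succAbove).det)
    rw [map_mul, map_pow, map_neg, map_one, zsmul_eq_mul]
    push_cast
    rfl

theorem coe_isUnit_aux {f : EvR N} (hi : (f : SF N).Invertible) :
    ∃ e : EvR N, (e : SF N) = (f : SF N).sinv ∧ f * e = 1 :=
  ⟨⟨(f : SF N).sinv, SF.Smooth.sinv f.2.1 hi, f.2.2.sinv hi⟩, rfl, Subtype.ext (SF.mul_sinv hi)⟩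

theorem invSF_coe {k : ℕ} (M : Matrix (Fin k) (Fin k) (EvR N))
    (hi : ((M.det : EvR N) : SF N).Invertible) :
    invSF (M.map (fun r => (r : SF N))) = M⁻¹.map (fun r => (r : SF N)) := by
  obtain ⟨e, he, h1⟩ := coe_isUnit_aux hi
  refine Matrix.ext fun i j => ?_
  simp only [invSF, Matrix.of_apply, adjSF_coe, detSF_coe, Matrix.map_apply]
  have hu : IsUnit M.det := IsUnit.of_mul_eq_one _ h1
  have h2 : Ring.inverse M.det = e := by
    apply hu.mul_left_cancel
    rw [h1, Ring.mul_inverse_cancel _ hu]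
  rw [Matrix.inv_def, h2, ← he]
  rfl

theorem Dpow_even (m : ℕ) (f : SF N) : Dpow (2 * m) f = Xpow m f := by
  induction m with
  | zero => rfl
  | succ m ih =>
    have : Dpow (2 * (m + 1)) f = (Dpow (2 * m) f).Dsd.Dsd := rfl
    rw [this, ih]; rfl

theorem Dpow_odd (m : ℕ) (f : SF N) : Dpow (2 * m + 1) f = (Xpow m f).Dsd := by
  rw [← Dpow_even]; rfl

theorem sum_split {B : Type*} [AddCommMonoid B] (k : ℕ) (f : Fin (2 * k) → B) :
    ∑ i, f i = ∑ l : Fin k, f ⟨2 * l.1, by omega⟩ + ∑ l : Fin k, f ⟨2 * l.1 + 1, by omega⟩ := by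
  let g : ℕ → B := fun n => if h : n < 2 * k then f ⟨n, h⟩ else 0
  have h0 : ∀ m, ∑ n ∈ Finset.range (2 * m), g n =
      ∑ l ∈ Finset.range m, g (2 * l) + ∑ l ∈ Finset.range m, g (2 * l + 1) := by
    intro m
    induction m with
    | zero => simp
    | succ m ih =>
      rw [show 2 * (m + 1) = 2 * m + 1 + 1 by ring, Finset.sum_range_succ, Finset.sum_range_succ, ih,
        Finset.sum_range_succ, Finset.sum_range_succ]
      abel
  have h1 := h0 k
  rw [Finset.sum_range, Finset.sum_range, Finset.sum_range] at h1
  have e1 : ∀ i : Fin (2 * k), g i.1 = f i := fun i => by simp [g]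
  have e2 : ∀ l : Fin k, g (2 * l.1) = f ⟨2 * l.1, by omega⟩ := fun l => by
    simp only [g]; rw [dif_pos]
  have e3 : ∀ l : Fin k, g (2 * l.1 + 1) = f ⟨2 * l.1 + 1, by omega⟩ := fun l => by
    simp only [g]; rw [dif_pos]
  simpa only [e1, e2, e3] using h1

theorem key_rel {k : ℕ} (a : Fin (2*k) → SF N) (v : SF N)
    (hker : Xpow k v + ∑ i : Fin (2*k), a i * Dpow i.1 v = 0) (i : Fin k) :
    Xpow (i.1 + 1) v = ∑ l : Fin k, (if i.1 + 1 = k then - a ⟨2 * l.1, by omega⟩ else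
        if l.1 = i.1 + 1 then 1 else 0) * Xpow l.1 v +
      ∑ l : Fin k, (if i.1 + 1 = k then - a ⟨2 * l.1 + 1, by omega⟩ else 0) * (Xpow l.1 v).Dsd := by
  by_cases h : i.1 + 1 = k
  · simp only [if_pos h]
    rw [sum_split] at hker
    simp only [Dpow_even, Dpow_odd] at hker
    rw [h, eq_neg_of_add_eq_zero_left hker]
    simp only [neg_mul, Finset.sum_neg_distrib]
    abel
  · simp only [if_neg h]
    have hi : i.1 + 1 < k := by omega
    rw [Finset.sum_eq_single (⟨i.1 + 1, hi⟩ : Fin k)]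
    · simp
    · intro b _ hb
      have : b.1 ≠ i.1 + 1 := fun h => hb (Fin.ext h)
      rw [if_neg this, zero_mul]
    · simp

theorem main_aux (k : ℕ) (hk : 1 ≤ k) (θ : ℕ → SF N)
    (hθs : ∀ j < 2*k, (θ j).Smooth) (hθp : ∀ j < 2*k, parityAt (θ j) j)
    (a : Fin (2*k) → SF N) (hap : ∀ i : Fin (2*k), parityAt (a i) i.1)
    (has : ∀ i : Fin (2*k), (a i).Smooth)
    (hker : ∀ j < 2*k, Xpow k (θ j) + ∑ i : Fin (2*k), a i * Dpow i.1 (θ j) = 0)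
    (h1i : (detSF (DmatSF (W1E N k θ))).Invertible)
    (h2i : (detSF (SchurE N k θ)).Invertible) :
    a ⟨2*k-1, by omega⟩ = (sdetE N k θ).Dsd * (sdetE N k θ).sinv := by
  -- parity and smoothness of entries
  have se : ∀ j : Fin k, (θ (2 * j.1)).Smooth := fun j => hθs _ (by omega)
  have so : ∀ j : Fin k, (θ (2 * j.1 + 1)).Smooth := fun j => hθs _ (by omega)
  have pe : ∀ j : Fin k, (θ (2 * j.1)).Ev := fun j => by
    have := hθp (2 * j.1) (by omega)
    rw [parityAt, if_pos (by omega)] at this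
    exact this.ev
  have po : ∀ j : Fin k, (θ (2 * j.1 + 1)).Od := fun j => by
    have := hθp (2 * j.1 + 1) (by omega)
    rw [parityAt, if_neg (by omega)] at this
    exact this.od
  have ae : ∀ j : Fin k, (a ⟨2 * j.1, by omega⟩).Ev := fun j => by
    have := hap ⟨2 * j.1, by omega⟩
    rw [parityAt, if_pos (by simp)] at this
    exact this.ev
  let W0 : Matrix (Fin k) (Fin k) (EvR N) := Matrix.of fun i j =>
    ⟨Xpow i.1 (θ (2 * j.1)), (se j).Xpow _, (pe j).Xpow (se j) _⟩
  let W1 : Matrix (Fin k) (Fin k) (SmR N) := Matrix.of fun i j =>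
    ⟨Xpow i.1 (θ (2 * j.1 + 1)), (so j).Xpow _⟩
  let E : Matrix (Fin k) (Fin k) (EvR N) := Matrix.of fun i j =>
    ⟨(Xpow i.1 (θ (2 * j.1 + 1))).Dsd, ((so j).Xpow _).Dsd, ((po j).Xpow (so j) _).Dsd ((so j).Xpow _)⟩
  let K : Matrix (Fin k) (Fin k) (EvR N) := Matrix.of fun i l =>
    if i.1 + 1 = k then - ⟨a ⟨2 * l.1, by omega⟩, has _, ae l⟩ else if l.1 = i.1 + 1 then 1 else 0
  let L : Matrix (Fin k) (Fin k) (SmR N) := Matrix.of fun i l =>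
    if i.1 + 1 = k then - ⟨a ⟨2 * l.1 + 1, by omega⟩, has _⟩ else 0
  have hKc : ∀ i l, ((K i l : EvR N) : SF N) = (if i.1 + 1 = k then - a ⟨2 * l.1, by omega⟩ else
        if l.1 = i.1 + 1 then 1 else 0) := by
    intro i l
    simp only [K, Matrix.of_apply]
    split_ifs <;> rfl
  have hLc : ∀ i l, ((L i l : SmR N) : SF N) =
      (if i.1 + 1 = k then - a ⟨2 * l.1 + 1, by omega⟩ else 0) := by
    intro i l
    simp only [L, Matrix.of_apply]
    split_ifs <;> rfl
  have hEc : E.map (fun r => (r : SF N)) = DmatSF (W1E N k θ) := rfl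
  have hW0c : W0.map (fun r => (r : SF N)) = W0E N k θ := rfl
  have hW1c : W1.map (fun r => (r : SF N)) = W1E N k θ := rfl
  have hEd : detSF (DmatSF (W1E N k θ)) = (E.det : EvR N) := by rw [← hEc]; exact detSF_coe E
  rw [hEd] at h1i
  have hinv : invSF (DmatSF (W1E N k θ)) = E⁻¹.map (fun r => (r : SF N)) := by
    rw [← hEc]; exact invSF_coe E h1i
  set φ := algebraMap (EvR N) (SmR N) with hφ
  let SA : Matrix (Fin k) (Fin k) (SmR N) :=
    W0.map φ - W1 * E⁻¹.map φ * (W0.map φ).map (DHom N)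
  have hSA : ∀ i j, ((SA i j : SmR N) : SF N) = SchurE N k θ i j := by
    intro i j
    change (SmR N).subtype (SA i j) = _
    simp only [SA, SchurE, Matrix.sub_apply, map_sub, hinv, Matrix.mul_apply, map_sum, map_mul]
    rfl
  have hSev : ∀ i j, (SchurE N k θ i j).Ev := by
    intro i j
    have h1 : ((W1E N k θ * invSF (DmatSF (W1E N k θ)) * DmatSF (W0E N k θ)) i j).Ev := by
      have : ∀ l, ((W1E N k θ * invSF (DmatSF (W1E N k θ))) i l * DmatSF (W0E N k θ) l j).Ev := by
        intro l
        refine SF.Od.mul ?_ (((pe j).Xpow (se j) _).Dsd ((se j).Xpow _))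
        rw [Matrix.mul_apply, hinv]
        exact SF.Od.sum _ _ fun m => ((po m).Xpow (so m) _).mul_ev (E⁻¹ m l).2.2
      rw [Matrix.mul_apply]
      have hs : ∀ (s : Finset (Fin k)), (∑ l ∈ s, (W1E N k θ * invSF (DmatSF (W1E N k θ))) i l * DmatSF (W0E N k θ) l j).Ev := by
        intro s
        induction s using Finset.induction_on with
        | empty => exact (EvR N).zero_mem.2
        | insert b s hb ih =>
          rw [Finset.sum_insert hb]
          exact ⟨fun x t => ((this b).1 x t).add (ih.1 x t), fun x t => ((this b).2 x t).add (ih.2 x t)⟩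
      exact hs _
    have h2 : (W0E N k θ i j).Ev := (pe j).Xpow (se j) _
    rw [SchurE, Matrix.sub_apply, sub_eq_add_neg]
    exact ⟨fun x t => (h2.1 x t).add (h1.1 x t).neg, fun x t => (h2.2 x t).add (h1.2 x t).neg⟩
  let S : Matrix (Fin k) (Fin k) (EvR N) := Matrix.of fun i j =>
    ⟨SchurE N k θ i j, by rw [← hSA]; exact (SA i j).2, hSev i j⟩
  have hSc : S.map (fun r => (r : SF N)) = SchurE N k θ := rfl
  have hSd : detSF (SchurE N k θ) = (S.det : EvR N) := by rw [← hSc]; exact detSF_coe S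
  rw [hSd] at h2i
  obtain ⟨e, he, hEe⟩ := coe_isUnit_aux h1i
  obtain ⟨s, hs, hSs⟩ := coe_isUnit_aux h2i
  have main := abstract_sdet (DHom N)
    (fun r x => Subtype.ext (r.2.2.leibniz r.2.1 x.2)) W0 E S K W1 L
    (fun i j y => Subtype.ext (((po j).Xpow (so j) _).leibniz ((so j).Xpow _) y.2))
    (by rfl) (IsUnit.of_mul_eq_one _ hEe) (IsUnit.of_mul_eq_one _ hSs)
    (by
      refine Matrix.ext fun i j => Subtype.ext ?_
      exact (hSA i j).symm)
    (by
      refine Matrix.ext fun i j => Subtype.ext ?_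
      have := key_rel a (θ (2 * j.1)) (hker _ (by omega)) i
      refine Eq.trans ?_ (this.trans ?_)
      · rfl
      · change _ = (SmR N).subtype ((K.map φ * W0.map φ + L * (W0.map φ).map (DHom N)) i j)
        rw [Matrix.add_apply, Matrix.mul_apply, Matrix.mul_apply, map_add, map_sum, map_sum]
        simp only [map_mul, ← hKc, ← hLc]
        rfl)
    (by
      refine Matrix.ext fun i j => Subtype.ext ?_
      have := key_rel a (θ (2 * j.1 + 1)) (hker _ (by omega)) i
      refine Eq.trans ?_ (this.trans ?_)
      · rfl
      · change _ = (SmR N).subtype ((K.map φ * W1 + L * E.map φ) i j)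
        rw [Matrix.add_apply, Matrix.mul_apply, Matrix.mul_apply, map_add, map_sum, map_sum]
        simp only [map_mul, ← hKc, ← hLc]
        rfl)
    e hEe
  have hsd : sdetE N k θ = ((S.det * e : EvR N) : SF N) := by
    rw [sdetE, hSd, hEd, ← he]; rfl
  have htr : ((- L.trace : SmR N) : SF N) = a ⟨2*k-1, by omega⟩ := by
    have : L.trace = L ⟨k - 1, by omega⟩ ⟨k - 1, by omega⟩ := by
      rw [Matrix.trace, Finset.sum_eq_single (⟨k - 1, by omega⟩ : Fin k)]
      · rfl
      · intro b _ hb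
        have : ¬ (b.1 + 1 = k) := fun h => hb (Fin.ext (by simp only; omega))
        simp only [L, Matrix.diag_apply, Matrix.of_apply, if_neg this]
      · simp
    rw [this]
    change - ((L _ _ : SmR N) : SF N) = _
    rw [hLc, if_pos (by simp only; omega), neg_neg]
    congr 2
    simp only; omega
  have main2 : (sdetE N k θ).Dsd = a ⟨2*k-1, by omega⟩ * sdetE N k θ := by
    rw [hsd, ← htr]
    exact congrArg Subtype.val main
  have hinvt : (sdetE N k θ).Invertible := by
    intro x t
    have h3 : (S.det * e) * (s * E.det) = 1 := by
      rw [mul_mul_mul_comm, hSs, mul_comm e, hEe, one_mul]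
    have h4 := congrArg (fun f : EvR N => (f : SF N).c0 x t) h3
    rw [hsd]
    have h5 : (s * E.det) * (S.det * e) = 1 := by rw [mul_comm, h3]
    have h6 := congrArg (fun f : EvR N => (f : SF N).c0 x t) h5
    exact ⟨⟨_, _, h4, h6⟩, rfl⟩
  rw [main2, mul_assoc, SF.mul_sinv hinvt, mul_one]

end ConcretePart

/-- in the even case `n = 2k`, `a_{2k−1} = (D sdet 𝒲)(sdet 𝒲)⁻¹ = D ln sdet 𝒲`. -/
theorem statement_7 {N : ℕ} (hN : 1 ≤ N) (k : ℕ) (hk : 1 ≤ k) (θ : ℕ → SF N)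
    (hθs : ∀ j < 2*k, (θ j).Smooth) (hθp : ∀ j < 2*k, parityAt (θ j) j)
    (a : Fin (2*k) → SF N) (hap : ∀ i : Fin (2*k), parityAt (a i) i.1)
    (has : ∀ i : Fin (2*k), (a i).Smooth)
    (hker : ∀ j < 2*k, Xpow k (θ j) + ∑ i : Fin (2*k), a i * Dpow i.1 (θ j) = 0)
    (h0e : (detSF (W0E N k θ)).IsEven)
    (h0i : (detSF (W0E N k θ)).Invertible)
    (h1e : (detSF (DmatSF (W1E N k θ))).IsEven)
    (h1i : (detSF (DmatSF (W1E N k θ))).Invertible)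
    (h2e : (detSF (SchurE N k θ)).IsEven)
    (h2i : (detSF (SchurE N k θ)).Invertible)
    (h3e : (detSF (SchurE2 N k θ)).IsEven)
    (h3i : (detSF (SchurE2 N k θ)).Invertible) :
    a ⟨2*k-1, by omega⟩ = (sdetE N k θ).Dsd * (sdetE N k θ).sinv := by
  exact main_aux k hk θ hθs hθp a hap has hker h1i h2i
end
end
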